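/- **Setting.** All signatures are multi-sorted with equality and all sorts are interpreted on nonempty sets. A *DB schema* is a pair $\langle\Sigma,T\rangle$ where $\Sigma$ is a finite signature whose only symbols are equality, unary function symbols and constants, and $T$ is a set of universal $\Sigma$-sentences; some of the sorts that are the source of no function symbol are designated as *value sorts*, and all other sorts are *id sorts*. A *DB instance* is a model of $T$ in which every id sort is finite. Assume that (a) $T$ has the finite model property: every $T$-satisfiable quantifier-free formula is satisfiable in a DB instance; (b) $T$-satisfiability of quantifier-free $\Sigma$-formulae is decidable; (c) $T$ has a model completion $T^*$, i.e. a first-order $\Sigma$-theory extending $T$ such that every model of $T$ embeds into a model of $T^*$ and $T^*$ eliminates quantifiers, and $T^*$ comes with an algorithm that turns every existential $\Sigma$-formula into a $T^*$-equivalent quantifier-free formula with the same free variables. Let $\Sigma_{ext}$ extend $\Sigma$ by finitely many fresh *artifact sorts* (the sorts of $\Sigma$ are called *basic*). A $\Sigma_{ext}$-structure is a model of $T$ (a DB instance, a model of $T^*$) if its reduct to $\Sigma$ is. Let $x$ be a finite tuple of individual variables of basic sorts and $a$ a finite tuple of unary function variables from artifact sorts to basic sorts. A *relational artifact system* (RAS)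 is $S=\langle\Sigma,T,\Sigma_{ext},x,a,\iota,\tau\rangle$ where $\iota$ is $\bigwedge_i x_i=c_i\wedge\bigwedge_j a_j=\lambda y.d_j$ with constants $c_i,d_j$ of $\Sigma$, and $\tau$ is a finite disjunction of formulae $$\exists e\,\Bigl(\gamma(e,x,a)\wedge\bigwedge_i x'_i=F_i(e,x,a)\wedge\bigwedge_j a'_j=\lambda y.\,G_j(y,e,x,a)\Bigr)$$ with $e$ of basic and artifact sorts, $\gamma$ quantifier-free, and $F_i,G_j$ case-defined: given by finitely many terms $t_1,\dots,t_n$ and quantifier-free conditions $\kappa_1,\dots,\kappa_n$ exactly one of which holds under every assignment in every model of $T$, the value being $t_l$ when $\kappa_l$ holds. A *state formula* is $\exists e\,\varphi(e,x,a)$ with $\varphi$ quantifier-free and $e$ of artifact sorts. $S$ is *safe* with respect to a state formula $\upsilon$ if there are no DB instance $M$ of $\langle\Sigma_{ext},T\rangle$, no $k\ge 0$ and no assignment in $M$ making $\iota(x^0,a^0)\wedge\tau(x^0,a^0,x^1,a^1)\wedge\dots\wedge\tau(x^{k-1},a^{k-1},x^k,a^k)\wedge\upsilon(x^k,a^k)$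 true. **Algorithm** $\mathsf{BReach}(\upsilon)$. Put $\phi:=\upsilon$, $B:=\bot$. While $\phi\wedge\neg B$ is $T$-satisfiable: if $\iota\wedge\phi$ is $T$-satisfiable, return *unsafe*; otherwise put $B:=\phi\vee B$, then $\phi:=\mathit{Pre}(\tau,\phi)$, then $\phi:=\mathsf{QE}(T^*,\phi)$. When the loop condition fails, return *(safe, B)*. Here $\mathit{Pre}(\tau,\phi)$ is $\exists x'\,\exists a'\,(\tau(x,a,x',a')\wedge\phi(x',a'))$, written up to equivalence modulo $T$ as an existential formula $\exists e\,\psi(e,x,a)$ with $\psi$ quantifier-free and $e$ of basic and artifact sorts, and $\mathsf{QE}(T^*,\cdot)$ turns such a formula into a state formula that is equivalent to it in all $\Sigma_{ext}$-models of $T^*$. **Theorem.** For every RAS $S$ as above, backward reachability is effective and partially correct: 1. (Effectiveness.) Each subprocedure can be effectively executed: it is decidable, for state formulae $\phi$ and finite disjunctions $B$ of state formulae, whether $\phi\wedge\neg B$ is $T$-satisfiable; it is decidable, for state formulae $\phi$, whether $\iota\wedge\phi$ is $T$-satisfiable; there is a computable function $\phi\mapsto\mathit{Pre}(\tau,\phi)$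 from state formulae to existential formulae; and there is a computable function $\mathsf{QE}(T^*,\cdot)$ from existential formulae to state formulae. 2. (Partial correctness, and soundness and completeness for detecting unsafety.) For every choice of the functions $\mathit{Pre}(\tau,\cdot)$ and $\mathsf{QE}(T^*,\cdot)$ as specified in the algorithm, and every state formula $\upsilon$: if $\mathsf{BReach}(\upsilon)$ terminates with answer *safe*, then $S$ is safe with respect to $\upsilon$; if it terminates with answer *unsafe*, then $S$ is not safe with respect to $\upsilon$; and if $S$ is not safe with respect to $\upsilon$, then $\mathsf{BReach}(\upsilon)$ terminates with answer *unsafe*. -/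

import Mathlib

namespace ArtifactSystems

/-! ### Signatures, terms, formulae, structures -/

/-- A DB signature: finitely many sorts, unary function symbols and constants (equality is
built into formulae). The sorts without outgoing function symbols are divided into unary
relations and value sorts; the sorts outside `valueSorts` are the id sorts. -/
structure DBSig where
  numSorts : ℕ
  numFuns : ℕ
  numConsts : ℕ
  src : Fin numFuns → Fin numSorts
  tgt : Fin numFuns → Fin numSorts
  constSort : Fin numConsts → Fin numSorts
  valueSorts : Finset (Fin numSorts)
  value_leaf : ∀ f, src f ∉ valueSorts

/-- The sorts of a DB signature. -/
abbrev DBSig.Srt (Sg : DBSig) : Type := Fin Sg.numSorts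

/-- `Var Γ s`: the variables of sort `s` in the context (list of sorted variables) `Γ`. -/
inductive Var {K : Type} : List K → K → Type
  | zero {Γ : List K} {s : K} : Var (s :: Γ) s
  | succ {Γ : List K} {s u : K} (v : Var Γ s) : Var (u :: Γ) s

/-- The position of a variable in its context. -/
def Var.idx {K : Type} : {Γ : List K} → {s : K} → Var Γ s → ℕ
  | _, _, .zero => 0
  | _, _, .succ v => v.idx + 1

/-- Assignments to the variables of a context, in a sorted family of carriers. -/
def Env {K : Type} (C : K → Type) (Γ : List K) : Type := ∀ s, Var Γ s → C s

/-- Extension of an assignment to one more variable. -/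
def Env.cons {K : Type} {C : K → Type} {Γ : List K} {u : K} (a : C u) (ρ : Env C Γ) :
    Env C (u :: Γ)
  | _, .zero => a
  | _, .succ v => ρ _ v

/-- Well-sorted terms over a sorted family `V` of variables. -/
inductive Term (Sg : DBSig) (V : Sg.Srt → Type) : Sg.Srt → Type
  | var {s : Sg.Srt} (v : V s) : Term Sg V s
  | const (c : Fin Sg.numConsts) : Term Sg V (Sg.constSort c)
  | app (f : Fin Sg.numFuns) (t : Term Sg V (Sg.src f)) : Term Sg V (Sg.tgt f)

/-- An equation between two terms of the same sort. -/
structure EqAtom (Sg : DBSig) (V : Sg.Srt → Type) where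
  sort : Sg.Srt
  lhs : Term Sg V sort
  rhs : Term Sg V sort

/-- Boolean combinations of atoms. -/
inductive BF (A : Type) : Type
  | atom (a : A) : BF A
  | bot : BF A
  | not (φ : BF A) : BF A
  | and (φ ψ : BF A) : BF A
  | or (φ ψ : BF A) : BF A

/-- Truth of a Boolean combination, given the truth values of the atoms. -/
def BF.Holds {A : Type} (v : A → Prop) : BF A → Prop
  | .atom a => v a
  | .bot => False
  | .not φ => ¬ φ.Holds v
  | .and φ ψ => φ.Holds v ∧ ψ.Holds v
  | .or φ ψ => φ.Holds v ∨ ψ.Holds v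

/-- Quantifier-free formulae over a sorted family of variables. -/
abbrev QF (Sg : DBSig) (V : Sg.Srt → Type) : Type := BF (EqAtom Sg V)

/-- First-order formulae with free variables in a context. -/
inductive Fml (Sg : DBSig) : List Sg.Srt → Type
  | eq {Γ : List Sg.Srt} (a : EqAtom Sg (Var Γ)) : Fml Sg Γ
  | bot {Γ : List Sg.Srt} : Fml Sg Γ
  | imp {Γ : List Sg.Srt} (φ ψ : Fml Sg Γ) : Fml Sg Γ
  | all {Γ : List Sg.Srt} (s : Sg.Srt) (φ : Fml Sg (s :: Γ)) : Fml Sg Γ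

/-- Multi-sorted structures (every sort is interpreted on a nonempty set). -/
structure Struct (Sg : DBSig) where
  carrier : Sg.Srt → Type
  nonempty : ∀ s, Nonempty (carrier s)
  fn : ∀ f, carrier (Sg.src f) → carrier (Sg.tgt f)
  const : ∀ c, carrier (Sg.constSort c)

/-- Value of a term. -/
def Term.eval {Sg : DBSig} {V : Sg.Srt → Type} (M : Struct Sg) (ρ : ∀ s, V s → M.carrier s) :
    {s : Sg.Srt} → Term Sg V s → M.carrier s
  | _, .var v => ρ _ v
  | _, .const c => M.const c
  | _, .app f t => M.fn f (t.eval M ρ)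

/-- Truth of an equation. -/
def EqAtom.Holds {Sg : DBSig} {V : Sg.Srt → Type} (M : Struct Sg)
    (ρ : ∀ s, V s → M.carrier s) (a : EqAtom Sg V) : Prop :=
  a.lhs.eval M ρ = a.rhs.eval M ρ

/-- Truth of a quantifier-free formula. -/
def QF.Holds {Sg : DBSig} {V : Sg.Srt → Type} (M : Struct Sg)
    (ρ : ∀ s, V s → M.carrier s) (φ : QF Sg V) : Prop :=
  BF.Holds (EqAtom.Holds M ρ) φ

/-- Truth of a first-order formula. -/
def Fml.Holds {Sg : DBSig} (M : Struct Sg) :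
    {Γ : List Sg.Srt} → Env M.carrier Γ → Fml Sg Γ → Prop
  | _, ρ, .eq a => a.Holds M ρ
  | _, _, .bot => False
  | _, ρ, .imp φ ψ => φ.Holds M ρ → ψ.Holds M ρ
  | _, ρ, .all s φ => ∀ b : M.carrier s, φ.Holds M (Env.cons b ρ)

/-- Embeddings of structures. -/
structure Embedding {Sg : DBSig} (M N : Struct Sg) where
  map : ∀ s, M.carrier s → N.carrier s
  injective : ∀ s, Function.Injective (map s)
  map_fn : ∀ f b, map _ (M.fn f b) = N.fn f (map _ b)
  map_const : ∀ c, map _ (M.const c) = N.const c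

/-! ### DB schemas and the requirements on them -/

/-- A quantifier-free formula together with the context of its free variables. -/
structure OpenFml (Sg : DBSig) where
  free : List Sg.Srt
  matrix : QF Sg (Var free)

/-- An existential formula `∃ y, φ(x, y)`, with `x` in `free`, `y` in `bound` and `φ`
quantifier-free. -/
structure ExFml (Sg : DBSig) where
  free : List Sg.Srt
  bound : List Sg.Srt
  matrix : QF Sg (fun s => Var free s ⊕ Var bound s)

/-- Truth of an existential formula. -/
def ExFml.Holds {Sg : DBSig} (M : Struct Sg) (φ : ExFml Sg) (ρ : Env M.carrier φ.free) : Prop :=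
  ∃ σ : Env M.carrier φ.bound, QF.Holds M (fun s => Sum.elim (ρ s) (σ s)) φ.matrix

/-- A DB schema `⟨Σ, T⟩`; an element `φ` of `theory` stands for its universal closure. -/
structure DBSchema where
  sig : DBSig
  theory : Set (OpenFml sig)

/-- Models of the DB theory. -/
def DBSchema.IsModel (D : DBSchema) (M : Struct D.sig) : Prop :=
  ∀ φ ∈ D.theory, ∀ ρ : Env M.carrier φ.free, QF.Holds M ρ φ.matrix

/-- DB instances: models of the DB theory whose id sorts are finite. -/
def DBSchema.IsInstance (D : DBSchema) (M : Struct D.sig) : Prop :=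
  D.IsModel M ∧ ∀ s, s ∉ D.sig.valueSorts → Finite (M.carrier s)

/-- `T`-satisfiability of a quantifier-free formula. -/
def DBSchema.Sat (D : DBSchema) (φ : OpenFml D.sig) : Prop :=
  ∃ M : Struct D.sig, D.IsModel M ∧ ∃ ρ : Env M.carrier φ.free, QF.Holds M ρ φ.matrix

/-- Finite model property (for constraint satisfiability). -/
def DBSchema.FiniteModelProperty (D : DBSchema) : Prop :=
  ∀ φ : OpenFml D.sig, D.Sat φ →
    ∃ M : Struct D.sig, D.IsInstance M ∧ ∃ ρ : Env M.carrier φ.free, QF.Holds M ρ φ.matrix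

/-- Models of a set of first-order sentences. -/
def IsModelOf {Sg : DBSig} (Ts : Set (Fml Sg [])) (M : Struct Sg) : Prop :=
  ∀ φ ∈ Ts, ∀ ρ : Env M.carrier [], φ.Holds M ρ

/-- `Ts` is a model completion of the universal theory `T`: it extends `T`, every model of `T`
embeds into a model of `Ts`, and `Ts` eliminates quantifiers. -/
structure DBSchema.IsModelCompletion (D : DBSchema) (Ts : Set (Fml D.sig [])) : Prop where
  extends_theory : ∀ M, IsModelOf Ts M → D.IsModel M
  embeds : ∀ M, D.IsModel M → ∃ N, IsModelOf Ts N ∧ Nonempty (Embedding M N)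
  quantifier_elimination : ∀ (Γ : List D.sig.Srt) (φ : Fml D.sig Γ), ∃ ψ : QF D.sig (Var Γ),
    ∀ M, IsModelOf Ts M → ∀ ρ : Env M.carrier Γ, φ.Holds M ρ ↔ QF.Holds M ρ ψ

/-! ### Writing formulae as finite words, and effectiveness -/

/-- A term over unary functions is a word of function symbols applied to a variable (given by
its number) or to a constant. -/
def Term.word {Sg : DBSig} {V : Sg.Srt → Type} (num : ∀ s, V s → ℕ) :
    {s : Sg.Srt} → Term Sg V s → List (Fin Sg.numFuns) × (ℕ ⊕ Fin Sg.numConsts)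
  | _, .var v => ([], .inl (num _ v))
  | _, .const c => ([], .inr c)
  | _, .app f t => (f :: (t.word num).1, (t.word num).2)

/-- Words for terms. -/
abbrev TermWord (Sg : DBSig) : Type := List (Fin Sg.numFuns) × (ℕ ⊕ Fin Sg.numConsts)

/-- Words for equations: the common sort and the two terms. -/
abbrev EqWord (Sg : DBSig) : Type := Fin Sg.numSorts × TermWord Sg × TermWord Sg

/-- The word of an equation. -/
def EqAtom.word {Sg : DBSig} {V : Sg.Srt → Type} (num : ∀ s, V s → ℕ) (a : EqAtom Sg V) :
    EqWord Sg :=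
  (a.sort, a.lhs.word num, a.rhs.word num)

/-- Prefix notation of a Boolean combination, as a word in atoms and four connectives
(`0` is falsity, `1` negation, `2` conjunction, `3` disjunction). -/
def BF.word {A W : Type} (c : A → W) : BF A → List (Fin 4 ⊕ W)
  | .atom a => [.inr (c a)]
  | .bot => [.inl 0]
  | .not φ => .inl 1 :: φ.word c
  | .and φ ψ => .inl 2 :: (φ.word c ++ ψ.word c)
  | .or φ ψ => .inl 3 :: (φ.word c ++ ψ.word c)

/-- The word of a quantifier-free formula in context. -/
def OpenFml.word {Sg : DBSig} (φ : OpenFml Sg) :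
    List (Fin Sg.numSorts) × List (Fin 4 ⊕ EqWord Sg) :=
  (φ.free, φ.matrix.word (EqAtom.word fun _ v => v.idx))

/-- The word of an existential formula; free variables get even numbers, bound ones odd ones. -/
def ExFml.word {Sg : DBSig} (φ : ExFml Sg) :
    List (Fin Sg.numSorts) × List (Fin Sg.numSorts) × List (Fin 4 ⊕ EqWord Sg) :=
  (φ.free, φ.bound, φ.matrix.word (EqAtom.word fun _ v =>
    Sum.elim (fun u => 2 * u.idx) (fun u => 2 * u.idx + 1) v))

/-- `Effective inp out`: a computable function yields the written output `out a` from the written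
input `inp a`, for every `a`. -/
def Effective {α P Q : Type} [Primcodable P] [Primcodable Q] (inp : α → P) (out : α → Q) : Prop :=
  ∃ g : P → Q, Computable g ∧ ∀ a, g (inp a) = out a

open Classical in
/-- A property of written inputs is decidable. -/
def EffectivelyDecidable {α P : Type} [Primcodable P] (inp : α → P) (p : α → Prop) : Prop :=
  Effective inp (fun a => decide (p a))

/-- Decidable constraint satisfiability. -/
def DBSchema.DecidableConstraintSat (D : DBSchema) : Prop :=
  EffectivelyDecidable (OpenFml.word (Sg := D.sig)) D.Sat

/-- `Ts` comes with a quantifier elimination algorithm (for existential formulae of the DB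
signature). -/
def HasEffectiveQE {Sg : DBSig} (Ts : Set (Fml Sg [])) : Prop :=
  ∃ qe : ∀ φ : ExFml Sg, QF Sg (Var φ.free),
    (∀ φ M, IsModelOf Ts M → ∀ ρ : Env M.carrier φ.free,
      φ.Holds M ρ ↔ QF.Holds M ρ (qe φ)) ∧
    Effective ExFml.word (fun φ => OpenFml.word ⟨φ.free, qe φ⟩)

/-! ### Artifact settings and their formulae -/

/-- An artifact extension of a DB signature (its artifact sorts) and an artifact setting over it:
artifact variables `x`, which have basic sorts, and artifact components `a`, which are unary
function variables from an artifact sort to a basic sort. -/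
structure ArtifactSetting (Sg : DBSig) where
  numArtSorts : ℕ
  numVars : ℕ
  varSort : Fin numVars → Sg.Srt
  numComps : ℕ
  compSrc : Fin numComps → Fin numArtSorts
  compTgt : Fin numComps → Sg.Srt

/-- The artifact sorts. -/
abbrev ArtifactSetting.ASrt {Sg : DBSig} (A : ArtifactSetting Sg) : Type := Fin A.numArtSorts

/-- Structures for the extended signature. -/
structure ExtStruct {Sg : DBSig} (A : ArtifactSetting Sg) where
  db : Struct Sg
  entries : A.ASrt → Type
  entries_nonempty : ∀ E, Nonempty (entries E)

/-- Assignments to the artifact setting. -/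
structure State {Sg : DBSig} {A : ArtifactSetting Sg} (M : ExtStruct A) where
  x : ∀ i, M.db.carrier (A.varSort i)
  a : ∀ j, M.entries (A.compSrc j) → M.db.carrier (A.compTgt j)

/-- The terms of basic sort of the extended language are built by function symbols from
constants and from: the artifact variables, the individual variables of basic sorts (in `Γ`), and
the reads `a_j[e]` at individual variables `e` of artifact sorts (in `Δ`). The only terms of an
artifact sort are the variables in `Δ`. -/
inductive AVar {Sg : DBSig} (A : ArtifactSetting Sg) (Δ : List A.ASrt) (Γ : List Sg.Srt) :
    Sg.Srt → Type
  | art (i : Fin A.numVars) : AVar A Δ Γ (A.varSort i)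
  | loc {s : Sg.Srt} (v : Var Γ s) : AVar A Δ Γ s
  | read (j : Fin A.numComps) (e : Var Δ (A.compSrc j)) : AVar A Δ Γ (A.compTgt j)

/-- Terms of basic sort of the extended language. -/
abbrev ATerm {Sg : DBSig} (A : ArtifactSetting Sg) (Δ : List A.ASrt) (Γ : List Sg.Srt)
    (s : Sg.Srt) : Type :=
  Term Sg (AVar A Δ Γ) s

/-- Atoms of the extended language: equations of basic sort and of artifact sort. -/
inductive AAtom {Sg : DBSig} (A : ArtifactSetting Sg) (Δ : List A.ASrt) (Γ : List Sg.Srt) : Type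
  | basicEq (q : EqAtom Sg (AVar A Δ Γ)) : AAtom A Δ Γ
  | artEq (E : A.ASrt) (e e' : Var Δ E) : AAtom A Δ Γ

/-- Quantifier-free formulae `φ(e, x, a)`, with the variables `e` in `Δ` and `Γ`. -/
abbrev AQF {Sg : DBSig} (A : ArtifactSetting Sg) (Δ : List A.ASrt) (Γ : List Sg.Srt) : Type :=
  BF (AAtom A Δ Γ)

section Semantics

variable {Sg : DBSig} {A : ArtifactSetting Sg} {Δ : List A.ASrt} {Γ : List Sg.Srt}

/-- Values of artifact variables, local variables and reads. -/
def AVar.eval {M : ExtStruct A} (st : State M) (δ : Env M.entries Δ) (ρ : Env M.db.carrier Γ) :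
    (s : Sg.Srt) → AVar A Δ Γ s → M.db.carrier s
  | _, .art i => st.x i
  | _, .loc v => ρ _ v
  | _, .read j e => st.a j (δ _ e)

/-- Value of a term of the extended language. -/
def ATerm.eval {M : ExtStruct A} (st : State M) (δ : Env M.entries Δ) (ρ : Env M.db.carrier Γ)
    {s : Sg.Srt} (t : ATerm A Δ Γ s) : M.db.carrier s :=
  Term.eval M.db (AVar.eval st δ ρ) t

/-- Truth of an atom of the extended language. -/
def AAtom.Holds {M : ExtStruct A} (st : State M) (δ : Env M.entries Δ)
    (ρ : Env M.db.carrier Γ) : AAtom A Δ Γ → Prop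
  | .basicEq q => q.Holds M.db (AVar.eval st δ ρ)
  | .artEq E e e' => δ E e = δ E e'

/-- Truth of a quantifier-free formula of the extended language. -/
def AQF.Holds {M : ExtStruct A} (st : State M) (δ : Env M.entries Δ)
    (ρ : Env M.db.carrier Γ) (φ : AQF A Δ Γ) : Prop :=
  BF.Holds (AAtom.Holds st δ ρ) φ

end Semantics

/-- State formulae `∃ e, φ(e, x, a)`, with `φ` quantifier-free and `e` of artifact sorts. -/
structure StateFormula {Sg : DBSig} (A : ArtifactSetting Sg) where
  arts : List A.ASrt
  matrix : AQF A arts []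

/-- Existential formulae `∃ e, φ(e, x, a)`, with `φ` quantifier-free and `e` of both artifact
and basic sorts. -/
structure ExistsFormula {Sg : DBSig} (A : ArtifactSetting Sg) where
  arts : List A.ASrt
  basics : List Sg.Srt
  matrix : AQF A arts basics

/-- Truth of a state formula in a state. -/
def StateFormula.Holds {Sg : DBSig} {A : ArtifactSetting Sg} {M : ExtStruct A} (st : State M)
    (φ : StateFormula A) : Prop :=
  ∃ (δ : Env M.entries φ.arts) (ρ : Env M.db.carrier []), AQF.Holds st δ ρ φ.matrix

/-- Truth of an existential formula in a state. -/
def ExistsFormula.Holds {Sg : DBSig} {A : ArtifactSetting Sg} {M : ExtStruct A} (st : State M)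
    (φ : ExistsFormula A) : Prop :=
  ∃ (δ : Env M.entries φ.arts) (ρ : Env M.db.carrier φ.basics), AQF.Holds st δ ρ φ.matrix

/-- Number of an artifact variable, local variable or read. -/
def AVar.num {Sg : DBSig} {A : ArtifactSetting Sg} {Δ : List A.ASrt} {Γ : List Sg.Srt} :
    (s : Sg.Srt) → AVar A Δ Γ s → ℕ
  | _, .art i => 3 * i.val
  | _, .loc v => 3 * v.idx + 1
  | _, .read j e => 3 * Nat.pair j.val e.idx + 2

/-- The word of an atom of the extended language. -/
def AAtom.word {Sg : DBSig} {A : ArtifactSetting Sg} {Δ : List A.ASrt} {Γ : List Sg.Srt} :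
    AAtom A Δ Γ → EqWord Sg ⊕ (ℕ × ℕ)
  | .basicEq q => .inl (q.word AVar.num)
  | .artEq _ e e' => .inr (e.idx, e'.idx)

/-- The word of a state formula. -/
def StateFormula.word {Sg : DBSig} {A : ArtifactSetting Sg} (φ : StateFormula A) :
    List (Fin A.numArtSorts) × List (Fin 4 ⊕ (EqWord Sg ⊕ (ℕ × ℕ))) :=
  (φ.arts, φ.matrix.word AAtom.word)

/-- The word of an existential formula of the extended language. -/
def ExistsFormula.word {Sg : DBSig} {A : ArtifactSetting Sg} (φ : ExistsFormula A) :
    List (Fin A.numArtSorts) × List (Fin Sg.numSorts) ×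
      List (Fin 4 ⊕ (EqWord Sg ⊕ (ℕ × ℕ))) :=
  (φ.arts, φ.basics, φ.matrix.word AAtom.word)

/-! ### Relational artifact systems -/

/-- A case-defined function `case of {κ₁ : t₁; …; κₙ : tₙ}`. -/
structure CaseFun {Sg : DBSig} (A : ArtifactSetting Sg) (Δ : List A.ASrt) (Γ : List Sg.Srt)
    (s : Sg.Srt) where
  cases : List (AQF A Δ Γ × ATerm A Δ Γ s)

/-- The conditions of a case-defined function form a `T`-partition. -/
def CaseFun.IsPartition {D : DBSchema} {A : ArtifactSetting D.sig} {Δ : List A.ASrt}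
    {Γ : List D.sig.Srt} {s : D.sig.Srt} (F : CaseFun A Δ Γ s) : Prop :=
  ∀ M : ExtStruct A, D.IsModel M.db → ∀ (st : State M) (δ : Env M.entries Δ)
    (ρ : Env M.db.carrier Γ),
    (∃ p ∈ F.cases, AQF.Holds st δ ρ p.1) ∧
    F.cases.Pairwise (fun p q => ¬ (AQF.Holds st δ ρ p.1 ∧ AQF.Holds st δ ρ q.1))

/-- The formula `b = F(e, x, a)`: for every case, `κᵢ → b = tᵢ`. -/
def CaseFun.HasValue {Sg : DBSig} {A : ArtifactSetting Sg} {Δ : List A.ASrt}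
    {Γ : List Sg.Srt} {s : Sg.Srt} {M : ExtStruct A} (F : CaseFun A Δ Γ s) (st : State M)
    (δ : Env M.entries Δ) (ρ : Env M.db.carrier Γ) (b : M.db.carrier s) : Prop :=
  ∀ p ∈ F.cases, AQF.Holds st δ ρ p.1 → b = ATerm.eval st δ ρ p.2

/-- Transition formulae
`∃ e (γ(e,x,a) ∧ ⋀ᵢ x'ᵢ = Fᵢ(e,x,a) ∧ ⋀ⱼ a'ⱼ = λ y. Gⱼ(y,e,x,a))`; the variable `y` of `Gⱼ` is
the first artifact variable of its context. -/
structure Transition (D : DBSchema) (A : ArtifactSetting D.sig) where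
  arts : List A.ASrt
  basics : List D.sig.Srt
  guard : AQF A arts basics
  updX : ∀ i, CaseFun A arts basics (A.varSort i)
  updA : ∀ j, CaseFun A (A.compSrc j :: arts) basics (A.compTgt j)
  updX_partition : ∀ i, (updX i).IsPartition (D := D)
  updA_partition : ∀ j, (updA j).IsPartition (D := D)

/-- Truth of a transition formula on a pair of states. -/
def Transition.Holds {D : DBSchema} {A : ArtifactSetting D.sig} (t : Transition D A)
    {M : ExtStruct A} (st st' : State M) : Prop :=
  ∃ (δ : Env M.entries t.arts) (ρ : Env M.db.carrier t.basics),
    AQF.Holds st δ ρ t.guard ∧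
    (∀ i, (t.updX i).HasValue st δ ρ (st'.x i)) ∧
    (∀ j (y : M.entries (A.compSrc j)), (t.updA j).HasValue st (Env.cons y δ) ρ (st'.a j y))

/-- A relational artifact system over a DB schema: an artifact setting, an initial formula
`⋀ xᵢ = cᵢ ∧ ⋀ aⱼ = λ y. dⱼ`, and a disjunction `τ` of transition formulae. -/
structure RAS (D : DBSchema) where
  setting : ArtifactSetting D.sig
  initX : ∀ i, {c : Fin D.sig.numConsts // D.sig.constSort c = setting.varSort i}
  initA : ∀ j, {c : Fin D.sig.numConsts // D.sig.constSort c = setting.compTgt j}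
  trans : List (Transition D setting)

section System

variable {D : DBSchema} (S : RAS D)

/-- The initial formula `ι`. -/
def RAS.Init {M : ExtStruct S.setting} (st : State M) : Prop :=
  (∀ i, st.x i = (S.initX i).2 ▸ M.db.const (S.initX i).1) ∧
  (∀ j y, st.a j y = (S.initA j).2 ▸ M.db.const (S.initA j).1)

/-- The transition relation `τ`. -/
def RAS.Step {M : ExtStruct S.setting} (st st' : State M) : Prop :=
  ∃ t ∈ S.trans, t.Holds st st'

/-- `S` is safe with respect to `υ`: in no DB instance does a finite run lead from `ι` to `υ`. -/
def RAS.Safe (υ : StateFormula S.setting) : Prop :=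
  ¬ ∃ M : ExtStruct S.setting, D.IsInstance M.db ∧ ∃ (k : ℕ) (run : Fin (k + 1) → State M),
    S.Init (run 0) ∧ (∀ i : Fin k, S.Step (run i.castSucc) (run i.succ)) ∧
      υ.Holds (run (Fin.last k))

/-! ### Backward reachability -/

/-- The test of the loop: `φ ∧ ¬B` is `T`-satisfiable, `B` being the disjunction of a list. -/
def RAS.FrontierSat (φ : StateFormula S.setting) (B : List (StateFormula S.setting)) : Prop :=
  ∃ M : ExtStruct S.setting, D.IsModel M.db ∧ ∃ st : State M,
    φ.Holds st ∧ ¬ ∃ ψ ∈ B, ψ.Holds st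

/-- The disjointness test: `ι ∧ φ` is `T`-satisfiable. -/
def RAS.InitSat (φ : StateFormula S.setting) : Prop :=
  ∃ M : ExtStruct S.setting, D.IsModel M.db ∧ ∃ st : State M, S.Init st ∧ φ.Holds st

/-- `pre` computes preimages: modulo `T`, `pre φ` is `Pre(τ, φ)`, that is
`∃ x' a' (τ(x, a, x', a') ∧ φ(x', a'))`. -/
def RAS.IsPreimage (pre : StateFormula S.setting → ExistsFormula S.setting) : Prop :=
  ∀ φ (M : ExtStruct S.setting), D.IsModel M.db → ∀ st : State M,
    (pre φ).Holds st ↔ ∃ st' : State M, S.Step st st' ∧ φ.Holds st'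

/-- `qe` eliminates the quantified variables of basic sorts, modulo `Ts`. -/
def RAS.IsQE (Ts : Set (Fml D.sig [])) (qe : ExistsFormula S.setting → StateFormula S.setting) :
    Prop :=
  ∀ φ (M : ExtStruct S.setting), IsModelOf Ts M.db → ∀ st : State M,
    (qe φ).Holds st ↔ φ.Holds st

/-- Answers of the algorithm: "unsafe", or "safe" together with the final `B`. -/
inductive Answer (S : RAS D) : Type
  | unsafeAnswer : Answer S
  | safeAnswer (B : List (StateFormula S.setting)) : Answer S

/-- `S.Loop pre qe φ B r`: the while loop of backward reachability, entered with current values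
`φ` and `B` of its two variables, terminates and returns `r`. -/
inductive RAS.Loop (pre : StateFormula S.setting → ExistsFormula S.setting)
    (qe : ExistsFormula S.setting → StateFormula S.setting) :
    StateFormula S.setting → List (StateFormula S.setting) → Answer S → Prop
  | fixpoint (φ : StateFormula S.setting) (B : List (StateFormula S.setting)) :
      ¬ S.FrontierSat φ B → RAS.Loop pre qe φ B (.safeAnswer B)
  | hit (φ : StateFormula S.setting) (B : List (StateFormula S.setting)) :
      S.FrontierSat φ B → S.InitSat φ → RAS.Loop pre qe φ B .unsafeAnswer
  | next (φ : StateFormula S.setting) (B : List (StateFormula S.setting)) (r : Answer S) :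
      S.FrontierSat φ B → ¬ S.InitSat φ → RAS.Loop pre qe (qe (pre φ)) (φ :: B) r →
      RAS.Loop pre qe φ B r

/-- `BReach(υ)` terminates and returns `r`. -/
def RAS.BReach (pre : StateFormula S.setting → ExistsFormula S.setting)
    (qe : ExistsFormula S.setting → StateFormula S.setting) (υ : StateFormula S.setting)
    (r : Answer S) : Prop :=
  S.Loop pre qe υ [] r

end System

end ArtifactSystems

open ArtifactSystems

namespace ArtifactSystems

/-! ### Closure properties of primitive recursive and computable functions -/

attribute [fun_prop] Primrec

section Primrec

variable {α β γ σ : Type} [Primcodable α] [Primcodable β] [Primcodable γ] [Primcodable σ]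

@[fun_prop] theorem primrec_id : Primrec (fun a : α => a) := Primrec.id

@[fun_prop] theorem primrec_const (x : σ) : Primrec (fun _ : α => x) := Primrec.const x

@[fun_prop] theorem primrec_comp {f : β → σ} {g : α → β} (hf : Primrec f) (hg : Primrec g) :
    Primrec fun a => f (g a) := hf.comp hg

@[fun_prop] theorem primrec_pair {f : α → β} {g : α → γ} (hf : Primrec f) (hg : Primrec g) :
    Primrec fun a => (f a, g a) := hf.pair hg

@[fun_prop] theorem primrec_fst {f : α → β × γ} (hf : Primrec f) : Primrec fun a => (f a).1 :=
  Primrec.fst.comp hf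

@[fun_prop] theorem primrec_snd {f : α → β × γ} (hf : Primrec f) : Primrec fun a => (f a).2 :=
  Primrec.snd.comp hf

@[fun_prop] theorem primrec_inl {f : α → β} (hf : Primrec f) :
    Primrec fun a => (Sum.inl (f a) : β ⊕ γ) :=
  Primrec.sumInl.comp hf

@[fun_prop] theorem primrec_inr {f : α → γ} (hf : Primrec f) :
    Primrec fun a => (Sum.inr (f a) : β ⊕ γ) :=
  Primrec.sumInr.comp hf

@[fun_prop] theorem primrec_sum_elim {f : α → β ⊕ γ} {g : α → β → σ} {h : α → γ → σ}
    (hf : Primrec f) (hg : Primrec fun p : α × β => g p.1 p.2)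
    (hh : Primrec fun p : α × γ => h p.1 p.2) :
    Primrec fun a => Sum.elim (g a) (h a) (f a) :=
  (Primrec.sumCasesOn hf hg hh).of_eq fun a => by cases f a <;> rfl

@[fun_prop] theorem primrec_append {f g : α → List β} (hf : Primrec f) (hg : Primrec g) :
    Primrec fun a => f a ++ g a := Primrec.list_append.comp hf hg

@[fun_prop] theorem primrec_cons {f : α → β} {g : α → List β} (hf : Primrec f)
    (hg : Primrec g) : Primrec fun a => f a :: g a := Primrec.list_cons.comp hf hg

@[fun_prop] theorem primrec_flatMap {f : α → List β} {g : α → β → List σ} (hf : Primrec f)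
    (hg : Primrec fun p : α × β => g p.1 p.2) : Primrec fun a => (f a).flatMap (g a) :=
  Primrec.list_flatMap hf hg

@[fun_prop] theorem primrec_map {f : α → List β} {g : α → β → σ} (hf : Primrec f)
    (hg : Primrec fun p : α × β => g p.1 p.2) : Primrec fun a => (f a).map (g a) :=
  Primrec.list_map hf hg

@[fun_prop] theorem primrec_foldr {f : α → List β} {g : α → σ} {h : α → β → σ → σ}
    (hf : Primrec f) (hg : Primrec g) (hh : Primrec fun p : α × β × σ => h p.1 p.2.1 p.2.2) :
    Primrec fun a => (f a).foldr (h a) (g a) :=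
  Primrec.list_foldr (h := fun a p => h a p.1 p.2) hf hg hh

@[fun_prop] theorem primrec_getD {f : α → List β} {g : α → ℕ} {d : α → β} (hf : Primrec f)
    (hg : Primrec g) (hd : Primrec d) : Primrec fun a => ((f a)[g a]?).getD (d a) :=
  Primrec.option_getD.comp (Primrec.list_getElem?.comp hf hg) hd

@[fun_prop] theorem primrec_idxOf {f : α → List ℕ} {g : α → ℕ} (hf : Primrec f)
    (hg : Primrec g) : Primrec fun a => (f a).idxOf (g a) :=
  Primrec.list_idxOf.comp hg hf

@[fun_prop] theorem primrec_add {f g : α → ℕ} (hf : Primrec f) (hg : Primrec g) :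
    Primrec fun a => f a + g a := Primrec.nat_add.comp hf hg

@[fun_prop] theorem primrec_sub {f g : α → ℕ} (hf : Primrec f) (hg : Primrec g) :
    Primrec fun a => f a - g a := Primrec.nat_sub.comp hf hg

@[fun_prop] theorem primrec_mul {f g : α → ℕ} (hf : Primrec f) (hg : Primrec g) :
    Primrec fun a => f a * g a := Primrec.nat_mul.comp hf hg

@[fun_prop] theorem primrec_div {f g : α → ℕ} (hf : Primrec f) (hg : Primrec g) :
    Primrec fun a => f a / g a := Primrec.nat_div.comp hf hg

@[fun_prop] theorem primrec_mod {f g : α → ℕ} (hf : Primrec f) (hg : Primrec g) :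
    Primrec fun a => f a % g a := Primrec.nat_mod.comp hf hg

@[fun_prop] theorem primrec_natPair {f g : α → ℕ} (hf : Primrec f) (hg : Primrec g) :
    Primrec fun a => Nat.pair (f a) (g a) := Primrec₂.natPair.comp hf hg

@[fun_prop] theorem primrec_unpair {f : α → ℕ} (hf : Primrec f) :
    Primrec fun a => Nat.unpair (f a) := Primrec.unpair.comp hf

@[fun_prop] theorem primrec_fin_val {n : ℕ} {f : α → Fin n} (hf : Primrec f) :
    Primrec fun a => (f a).val := Primrec.fin_val.comp hf

@[fun_prop] theorem primrec_dom_fin {n : ℕ} (g : Fin n → σ) {f : α → Fin n} (hf : Primrec f) :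
    Primrec fun a => g (f a) := (Primrec.dom_finite g).comp hf

@[fun_prop] theorem primrec_ite_eq [DecidableEq β] {f g : α → β} {h k : α → σ}
    (hf : Primrec f) (hg : Primrec g) (hh : Primrec h) (hk : Primrec k) :
    Primrec fun a => if f a = g a then h a else k a :=
  Primrec.ite (Primrec.eq.comp hf hg) hh hk

@[fun_prop] theorem primrec_ite_mem [BEq β] [LawfulBEq β] {f : α → β} {l : α → List β} {h k : α → σ}
    (hf : Primrec f) (hl : Primrec l) (hh : Primrec h) (hk : Primrec k) :
    Primrec fun a => if f a ∈ l a then h a else k a := by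
  have : PrimrecPred fun a => f a ∈ l a := by
    classical
    refine (Primrec.nat_lt.comp (Primrec.list_idxOf.comp hf hl)
      (Primrec.list_length.comp hl)).of_eq fun a => ?_
    simp [List.idxOf_lt_length_iff]
  exact Primrec.ite this hh hk

end Primrec

/-- Mapping a computable function over a list is computable. -/
theorem computable_list_map {α β : Type} [Primcodable α] [Primcodable β] {f : α → β}
    (hf : Computable f) : Computable (fun l : List α => l.map f) := by
  have h : Computable (fun l : List α => (Nat.rec (motive := fun _ => List β) []
      (fun n acc => acc ++ ((l[n]?).map f).toList) l.length : List β)) := by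
    refine Computable.nat_rec (h := fun (l : List α) (p : ℕ × List β) =>
      p.2 ++ ((l[p.1]?).map f).toList) Computable.list_length (Computable.const []) ?_
    refine Computable.list_append.comp (Computable.snd.comp Computable.snd)
      ((Primrec.optionToList.to_comp).comp (Computable.option_map ?_ ?_))
    · exact Computable.list_getElem?.comp Computable.fst (Computable.fst.comp Computable.snd)
    · exact hf.comp Computable.snd
  refine h.of_eq fun l => ?_
  have key : ∀ n, n ≤ l.length → (Nat.rec (motive := fun _ => List β) []
      (fun n acc => acc ++ ((l[n]?).map f).toList) n : List β) = (l.take n).map f := by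
    intro n
    induction n with
    | zero => intro _; simp
    | succ n ih =>
      intro hn
      have hlt : n < l.length := hn
      show _ ++ _ = _
      rw [ih (Nat.le_of_lt hlt), List.take_add_one, List.map_append]
      simp [hlt]
  rw [key _ le_rfl, List.take_length]

/-! ### Boolean combinations -/

namespace BF

variable {A B W W' : Type}

/-- Substitution of formulae for atoms. -/
def bind (h : A → BF B) : BF A → BF B
  | .atom a => h a
  | .bot => .bot
  | .not φ => .not (φ.bind h)
  | .and φ ψ => .and (φ.bind h) (ψ.bind h)
  | .or φ ψ => .or (φ.bind h) (ψ.bind h)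

/-- The true formula. -/
def top : BF A := .not .bot

/-- Finite disjunctions. -/
def disj (l : List (BF A)) : BF A := l.foldr .or .bot

/-- Finite conjunctions. -/
def conj (l : List (BF A)) : BF A := l.foldr .and .top

@[simp] theorem holds_top (v : A → Prop) : (top : BF A).Holds v ↔ True := by
  simp [top, Holds]

theorem holds_bind (h : A → BF B) (v : B → Prop) (φ : BF A) :
    (φ.bind h).Holds v ↔ φ.Holds (fun a => (h a).Holds v) := by
  induction φ <;> simp_all [bind, Holds]

theorem holds_congr {v w : A → Prop} (H : ∀ a, v a ↔ w a) (φ : BF A) :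
    φ.Holds v ↔ φ.Holds w := by
  have : v = w := funext fun a => propext (H a)
  rw [this]

theorem holds_disj (v : A → Prop) (l : List (BF A)) :
    (disj l).Holds v ↔ ∃ φ ∈ l, φ.Holds v := by
  induction l <;> simp_all [disj, Holds]

theorem holds_conj (v : A → Prop) (l : List (BF A)) :
    (conj l).Holds v ↔ ∀ φ ∈ l, φ.Holds v := by
  induction l <;> simp_all [conj, Holds]

/-- Substitution in words. -/
def wordBind (h : W → List (Fin 4 ⊕ W')) (w : List (Fin 4 ⊕ W)) : List (Fin 4 ⊕ W') :=
  w.flatMap (Sum.elim (fun k => [.inl k]) h)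

/-- The word of the true formula. -/
def topWord : List (Fin 4 ⊕ W) := [.inl 1, .inl 0]

/-- The word of a disjunction. -/
def disjWord (l : List (List (Fin 4 ⊕ W))) : List (Fin 4 ⊕ W) :=
  l.flatMap (fun w => .inl 3 :: w) ++ [.inl 0]

/-- The word of a conjunction. -/
def conjWord (l : List (List (Fin 4 ⊕ W))) : List (Fin 4 ⊕ W) :=
  l.flatMap (fun w => .inl 2 :: w) ++ topWord

theorem word_bind {c : A → W} {c' : B → W'} {h : A → BF B} {hw : W → List (Fin 4 ⊕ W')}
    (H : ∀ a, (h a).word c' = hw (c a)) (φ : BF A) :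
    (φ.bind h).word c' = wordBind hw (φ.word c) := by
  induction φ <;> simp_all [bind, word, wordBind]

theorem word_top (c : A → W) : (top : BF A).word c = topWord := rfl

theorem word_disj (c : A → W) (l : List (BF A)) :
    (disj l).word c = disjWord (l.map (word c)) := by
  induction l <;> simp_all [disj, disjWord, word]

theorem word_conj (c : A → W) (l : List (BF A)) :
    (conj l).word c = conjWord (l.map (word c)) := by
  induction l <;> simp_all [conj, conjWord, word, word_top]

section Primrec

variable {α : Type} [Primcodable α] [Primcodable W] [Primcodable W']

@[fun_prop] theorem primrec_wordBind {h : α → W → List (Fin 4 ⊕ W')} {w : α → List (Fin 4 ⊕ W)}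
    (hh : Primrec fun p : α × W => h p.1 p.2) (hw : Primrec w) :
    Primrec fun a => wordBind (h a) (w a) := by
  unfold wordBind
  fun_prop

@[fun_prop] theorem primrec_disjWord {l : α → List (List (Fin 4 ⊕ W))} (hl : Primrec l) :
    Primrec fun a => disjWord (l a) := by
  unfold disjWord
  fun_prop

@[fun_prop] theorem primrec_conjWord {l : α → List (List (Fin 4 ⊕ W))} (hl : Primrec l) :
    Primrec fun a => conjWord (l a) := by
  unfold conjWord
  fun_prop

end Primrec

end BF

/-! ### Renaming of variables -/

section Renaming

variable {Sg : DBSig} {V V' : Sg.Srt → Type}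

/-- Renaming of variables in a term. -/
def Term.ren (r : ∀ s, V s → V' s) : {s : Sg.Srt} → Term Sg V s → Term Sg V' s
  | _, .var v => .var (r _ v)
  | _, .const c => .const c
  | _, .app f t => .app f (t.ren r)

/-- Renaming of variables in an equation. -/
def EqAtom.ren (r : ∀ s, V s → V' s) (q : EqAtom Sg V) : EqAtom Sg V' :=
  ⟨q.sort, q.lhs.ren r, q.rhs.ren r⟩

theorem Term.eval_ren (M : Struct Sg) (r : ∀ s, V s → V' s) (ρ : ∀ s, V' s → M.carrier s)
    {s : Sg.Srt} (t : Term Sg V s) :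
    (t.ren r).eval M ρ = t.eval M (fun s v => ρ s (r s v)) := by
  induction t <;> simp_all [Term.ren, Term.eval]

theorem EqAtom.holds_ren (M : Struct Sg) (r : ∀ s, V s → V' s) (ρ : ∀ s, V' s → M.carrier s)
    (q : EqAtom Sg V) : (q.ren r).Holds M ρ ↔ q.Holds M (fun s v => ρ s (r s v)) := by
  simp [EqAtom.Holds, EqAtom.ren, Term.eval_ren]

/-- Renaming in the word of a term. -/
def TermWord.ren (r : ℕ → ℕ) (w : TermWord Sg) : TermWord Sg :=
  (w.1, Sum.elim (fun n => .inl (r n)) .inr w.2)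

/-- Renaming in the word of an equation. -/
def EqWord.ren (r : ℕ → ℕ) (w : EqWord Sg) : EqWord Sg :=
  (w.1, TermWord.ren r w.2.1, TermWord.ren r w.2.2)

theorem Term.word_ren {num : ∀ s, V s → ℕ} {num' : ∀ s, V' s → ℕ} {r : ∀ s, V s → V' s}
    {rw : ℕ → ℕ} (H : ∀ s v, num' s (r s v) = rw (num s v)) {s : Sg.Srt} (t : Term Sg V s) :
    (t.ren r).word num' = TermWord.ren rw (t.word num) := by
  induction t <;> simp_all [Term.ren, Term.word, TermWord.ren]

theorem EqAtom.word_ren {num : ∀ s, V s → ℕ} {num' : ∀ s, V' s → ℕ} {r : ∀ s, V s → V' s}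
    {rw : ℕ → ℕ} (H : ∀ s v, num' s (r s v) = rw (num s v)) (q : EqAtom Sg V) :
    (q.ren r).word num' = EqWord.ren rw (q.word num) := by
  simp [EqAtom.word, EqAtom.ren, EqWord.ren, Term.word_ren H]

section Primrec

variable {α : Type} [Primcodable α]

@[fun_prop] theorem TermWord.primrec_ren {r : α → ℕ → ℕ} {w : α → TermWord Sg}
    (hr : Primrec fun p : α × ℕ => r p.1 p.2) (hw : Primrec w) :
    Primrec fun a => TermWord.ren (r a) (w a) := by
  unfold TermWord.ren
  fun_prop

@[fun_prop] theorem EqWord.primrec_ren {r : α → ℕ → ℕ} {w : α → EqWord Sg}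
    (hr : Primrec fun p : α × ℕ => r p.1 p.2) (hw : Primrec w) :
    Primrec fun a => EqWord.ren (r a) (w a) := by
  unfold EqWord.ren
  fun_prop

end Primrec

/-- Renaming of variables in a quantifier-free formula. -/
def QF.ren (r : ∀ s, V s → V' s) (φ : QF Sg V) : QF Sg V' := φ.bind fun q => .atom (q.ren r)

theorem QF.holds_ren (M : Struct Sg) (r : ∀ s, V s → V' s) (ρ : ∀ s, V' s → M.carrier s)
    (φ : QF Sg V) : QF.Holds M ρ (QF.ren r φ) ↔ QF.Holds M (fun s v => ρ s (r s v)) φ := by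
  unfold QF.Holds QF.ren
  rw [BF.holds_bind]
  exact BF.holds_congr (fun q => EqAtom.holds_ren M r ρ q) φ

/-- Renaming in the word of a quantifier-free formula. -/
def qfWordRen (r : ℕ → ℕ) (w : List (Fin 4 ⊕ EqWord Sg)) : List (Fin 4 ⊕ EqWord Sg) :=
  BF.wordBind (fun q => [.inr (EqWord.ren r q)]) w

theorem QF.word_ren {num : ∀ s, V s → ℕ} {num' : ∀ s, V' s → ℕ} {r : ∀ s, V s → V' s}
    {rw : ℕ → ℕ} (H : ∀ s v, num' s (r s v) = rw (num s v)) (φ : QF Sg V) :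
    (QF.ren r φ).word (EqAtom.word num') = qfWordRen rw (φ.word (EqAtom.word num)) :=
  BF.word_bind (fun q => by simp [BF.word, EqAtom.word_ren H]) φ

@[fun_prop] theorem primrec_qfWordRen {α : Type} [Primcodable α] {r : α → ℕ → ℕ}
    {w : α → List (Fin 4 ⊕ EqWord Sg)}
    (hr : Primrec fun p : α × ℕ => r p.1 p.2) (hw : Primrec w) :
    Primrec fun a => qfWordRen (r a) (w a) := by
  unfold qfWordRen
  fun_prop

end Renaming

/-! ### Variables and contexts -/

section Contexts

variable {K : Type}

theorem Var.getElem?_idx {Γ : List K} {s : K} (v : Var Γ s) : Γ[v.idx]? = some s := by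
  induction v with
  | zero => rfl
  | succ v ih => simpa [Var.idx] using ih

theorem Var.sigma_ext {Γ : List K} {s s' : K} (v : Var Γ s) (v' : Var Γ s')
    (h : v.idx = v'.idx) : (⟨s, v⟩ : Σ s, Var Γ s) = ⟨s', v'⟩ := by
  induction v generalizing s' with
  | zero => cases v' with
    | zero => rfl
    | succ v' => simp [Var.idx] at h
  | succ v ih => cases v' with
    | zero => simp [Var.idx] at h
    | succ v' =>
      have := ih v' (by simpa [Var.idx] using h)
      cases this
      rfl

theorem Var.ext_idx {Γ : List K} {s : K} {v v' : Var Γ s} (h : v.idx = v'.idx) : v = v' := by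
  have := Var.sigma_ext v v' h
  simpa using this

/-- There are no variables in the empty context. -/
def Var.elim0 {s : K} {α : Sort*} (v : Var ([] : List K) s) : α := nomatch v

/-- The empty assignment. -/
def Env.nil {C : K → Type} : Env C [] := fun _ v => v.elim0

theorem Env.eq_nil {C : K → Type} (ρ : Env C []) : ρ = Env.nil := by
  funext s v
  exact v.elim0

/-- The list of all variables of a context. -/
def vars : (Γ : List K) → List (Σ s, Var Γ s)
  | [] => []
  | s :: Γ => ⟨s, .zero⟩ :: (vars Γ).map fun p => ⟨p.1, .succ p.2⟩

theorem mem_vars {Γ : List K} {s : K} (v : Var Γ s) : (⟨s, v⟩ : Σ s, Var Γ s) ∈ vars Γ := by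
  induction v with
  | zero => simp [vars]
  | succ v ih => exact List.mem_cons_of_mem _ (List.mem_map_of_mem ih)

/-- The sorts and positions of all variables of a context. -/
def varsWord (Γ : List K) : List (K × ℕ) :=
  Γ.foldr (fun s l => (s, 0) :: l.map fun p => (p.1, p.2 + 1)) []

theorem map_vars (Γ : List K) : (vars Γ).map (fun p => (p.1, p.2.idx)) = varsWord Γ := by
  induction Γ with
  | nil => rfl
  | cons s Γ ih =>
    simp only [vars, varsWord, List.map_cons, List.map_map, List.foldr_cons]
    rw [← varsWord, ← ih, List.map_map]
    rfl

@[fun_prop] theorem primrec_varsWord {α : Type} [Primcodable α] [Primcodable K]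
    {l : α → List K} (hl : Primrec l) : Primrec fun a => varsWord (l a) := by
  unfold varsWord
  fun_prop

theorem getElem?_vars {Γ : List K} {s : K} (v : Var Γ s) : (vars Γ)[v.idx]? = some ⟨s, v⟩ := by
  induction v with
  | zero => rfl
  | succ v ih => simp [vars, Var.idx, ih]

/-- The list of positions assigned to the variables of a context. -/
def envWord {R Γ : List K} (g : Env (Var R) Γ) : List ℕ :=
  (vars Γ).map fun p => (g p.1 p.2).idx

theorem idx_env {R Γ : List K} (g : Env (Var R) Γ) (s : K) (v : Var Γ s) :
    (g s v).idx = ((envWord g)[v.idx]?).getD 0 := by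
  simp [envWord, getElem?_vars]

variable [DecidableEq K]

/-- The list of all variables of a given sort. -/
def varsOf (Γ : List K) (s : K) : List (Var Γ s) :=
  (vars Γ).flatMap fun p => if h : p.1 = s then [h ▸ p.2] else []

theorem mem_varsOf {Γ : List K} {s : K} (v : Var Γ s) : v ∈ varsOf Γ s :=
  List.mem_flatMap.2 ⟨⟨s, v⟩, mem_vars v, by simp⟩

/-- The positions of all variables of a given sort. -/
def varsOfWord (Γ : List K) (s : K) : List ℕ :=
  (varsWord Γ).flatMap fun p => if p.1 = s then [p.2] else []

theorem map_varsOf (Γ : List K) (s : K) : (varsOf Γ s).map Var.idx = varsOfWord Γ s := by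
  unfold varsOf varsOfWord
  rw [← map_vars, List.map_flatMap, List.flatMap_map]
  congr 1
  funext p
  obtain ⟨u, v⟩ := p
  by_cases h : u = s
  · subst h; simp
  · simp [h]

@[fun_prop] theorem primrec_varsOfWord {α : Type} [Primcodable α] [Primcodable K]
    {l : α → List K} {s : α → K} (hl : Primrec l) (hs : Primrec s) :
    Primrec fun a => varsOfWord (l a) (s a) := by
  unfold varsOfWord
  fun_prop

/-- The assignments of variables of `R` to the variables of a context. -/
def allEnvs (R : List K) : (Γ : List K) → List (Env (Var R) Γ)
  | [] => [Env.nil]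
  | s :: Γ => (varsOf R s).flatMap fun v => (allEnvs R Γ).map (Env.cons v)

theorem mem_allEnvs {R : List K} : ∀ {Γ : List K} (g : Env (Var R) Γ), g ∈ allEnvs R Γ
  | [], g => List.mem_singleton.2 g.eq_nil
  | s :: Γ, g => by
    refine List.mem_flatMap.2 ⟨g s .zero, mem_varsOf _, List.mem_map.2
      ⟨fun u v => g u (.succ v), mem_allEnvs _, ?_⟩⟩
    funext u v
    cases v <;> rfl

/-- The position lists of the assignments of variables of `R` to the variables of a context. -/
def allEnvsWord (R Γ : List K) : List (List ℕ) :=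
  Γ.foldr (fun s l => (varsOfWord R s).flatMap fun n => l.map fun w => n :: w) [[]]

theorem map_allEnvs (R Γ : List K) : (allEnvs R Γ).map envWord = allEnvsWord R Γ := by
  induction Γ with
  | nil => rfl
  | cons s Γ ih =>
    simp only [allEnvs, allEnvsWord, List.foldr_cons]
    rw [← allEnvsWord, ← ih, ← map_varsOf, List.map_flatMap, List.flatMap_map]
    congr 1
    funext v
    simp only [List.map_map]
    congr 1
    funext g
    simp only [envWord, vars, Function.comp_def, List.map_cons, List.map_map]
    rfl

@[fun_prop] theorem primrec_allEnvsWord {α : Type} [Primcodable α] [Primcodable K]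
    {R l : α → List K} (hR : Primrec R) (hl : Primrec l) :
    Primrec fun a => allEnvsWord (R a) (l a) := by
  unfold allEnvsWord
  fun_prop

end Contexts

/-- The sublists of a list. -/
def subs {β : Type} (l : List β) : List (List β) :=
  l.foldr (fun b acc => acc ++ acc.map fun m => b :: m) [[]]

theorem subs_cons {β : Type} (b : β) (l : List β) :
    subs (b :: l) = subs l ++ (subs l).map fun m => b :: m := rfl

theorem filter_mem_subs {β : Type} (p : β → Bool) (l : List β) : l.filter p ∈ subs l := by
  induction l with
  | nil => simp [subs]
  | cons b l ih =>
    rw [subs_cons, List.filter_cons]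
    split
    · exact List.mem_append_right _ (List.mem_map_of_mem ih)
    · exact List.mem_append_left _ ih

theorem map_subs {β γ : Type} (f : β → γ) (l : List β) :
    (subs l).map (List.map f) = subs (l.map f) := by
  induction l with
  | nil => rfl
  | cons b l ih =>
    rw [List.map_cons, subs_cons, subs_cons, ← ih]
    simp [Function.comp_def]

@[fun_prop] theorem primrec_subs {α β : Type} [Primcodable α] [Primcodable β] {l : α → List β}
    (hl : Primrec l) : Primrec fun a => subs (l a) := by
  unfold subs
  fun_prop

/-! ### Contexts listing a finite family of variables -/

section Listed

variable {K : Type} {V : K → Type}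

/-- The element of a list to which a variable of the context of its sorts refers. -/
def getVar : (L : List (Σ s, V s)) → {s : K} → Var (L.map Sigma.fst) s → V s
  | [], _, v => nomatch v
  | p :: _, _, .zero => p.2
  | _ :: L, _, .succ v => getVar L v

theorem getElem?_getVar (L : List (Σ s, V s)) {s : K} (x : Var (L.map Sigma.fst) s) :
    L[x.idx]? = some ⟨s, getVar L x⟩ := by
  induction L with
  | nil => cases x
  | cons p L ih =>
    cases x with
    | zero => rfl
    | succ x => simpa [Var.idx, getVar] using ih x

theorem exists_listed_var {num : ∀ s, V s → ℕ}
    (hn : ∀ s v s' v', num s v = num s' v' → (⟨s, v⟩ : Σ s, V s) = ⟨s', v'⟩)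
    (L : List (Σ s, V s)) {s : K} (v : V s) (hv : ⟨s, v⟩ ∈ L) :
    ∃ x : Var (L.map Sigma.fst) s, getVar L x = v ∧
      x.idx = (L.map fun p => num p.1 p.2).idxOf (num s v) := by
  induction L with
  | nil => simp at hv
  | cons p L ih =>
    by_cases h : num p.1 p.2 = num s v
    · have := hn _ _ _ _ h
      obtain ⟨u, w⟩ := p
      cases this
      exact ⟨.zero, rfl, by simp [Var.idx]⟩
    · have hmem : ⟨s, v⟩ ∈ L := by
        rcases List.mem_cons.1 hv with rfl | h'
        · exact absurd rfl h
        · exact h'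
      obtain ⟨x, hx, hi⟩ := ih hmem
      refine ⟨.succ x, hx, ?_⟩
      have : List.idxOf (num s v) ((p :: L).map fun p => num p.1 p.2) = _ :=
        List.idxOf_cons_ne _ h
      rw [this, ← hi]
      rfl

end Listed

/-! ### The variables of the extended language -/

section Extended

variable {Sg : DBSig} {A : ArtifactSetting Sg}

theorem AVar.num_injective {Δ : List A.ASrt} {Γ : List Sg.Srt} (s : Sg.Srt) (v : AVar A Δ Γ s)
    (s' : Sg.Srt) (v' : AVar A Δ Γ s') (h : AVar.num s v = AVar.num s' v') :
    (⟨s, v⟩ : Σ s, AVar A Δ Γ s) = ⟨s', v'⟩ := by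
  cases v with
  | art i => cases v' with
    | art i' =>
      have : i = i' := Fin.ext (by simp only [AVar.num] at h; omega)
      subst this; rfl
    | loc v' => simp only [AVar.num] at h; omega
    | read j' e' => simp only [AVar.num] at h; omega
  | loc v => cases v' with
    | art i' => simp only [AVar.num] at h; omega
    | loc v' =>
      have := Var.sigma_ext v v' (by simp only [AVar.num] at h; omega)
      cases this; rfl
    | read j' e' => simp only [AVar.num] at h; omega
  | read j e => cases v' with
    | art i' => simp only [AVar.num] at h; omega
    | loc v' => simp only [AVar.num] at h; omega
    | read j' e' =>
      have h' : Nat.pair j.val e.idx = Nat.pair j'.val e'.idx := by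
        simp only [AVar.num] at h; omega
      obtain ⟨hj, he⟩ := Nat.pair_eq_pair.1 h'
      have : j = j' := Fin.ext hj
      subst this
      rw [Var.ext_idx he]

/-- The list of all artifact variables, local variables and reads. -/
def allVars (A : ArtifactSetting Sg) (Δ : List A.ASrt) (Γ : List Sg.Srt) :
    List (Σ s, AVar A Δ Γ s) :=
  (List.finRange A.numVars).map (fun i => ⟨_, .art i⟩) ++
  ((vars Γ).map (fun p => ⟨_, .loc p.2⟩) ++
  (List.finRange A.numComps).flatMap fun j =>
    (varsOf Δ (A.compSrc j)).map fun e => ⟨_, .read j e⟩)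

theorem mem_allVars {Δ : List A.ASrt} {Γ : List Sg.Srt} {s : Sg.Srt} (v : AVar A Δ Γ s) :
    (⟨s, v⟩ : Σ s, AVar A Δ Γ s) ∈ allVars A Δ Γ := by
  unfold allVars
  cases v with
  | art i => exact List.mem_append_left _ (List.mem_map.2 ⟨i, List.mem_finRange i, rfl⟩)
  | loc v =>
    exact List.mem_append_right _ (List.mem_append_left _ (List.mem_map.2 ⟨_, mem_vars v, rfl⟩))
  | read j e =>
    exact List.mem_append_right _ (List.mem_append_right _ (List.mem_flatMap.2
      ⟨j, List.mem_finRange j, List.mem_map.2 ⟨e, mem_varsOf e, rfl⟩⟩))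

/-- Sorts and numbers of all artifact variables, local variables and reads. -/
def allVarsWord (A : ArtifactSetting Sg) (Δ : List A.ASrt) (Γ : List Sg.Srt) :
    List (Fin Sg.numSorts × ℕ) :=
  (List.finRange A.numVars).map (fun i => (A.varSort i, 3 * i.val)) ++
  ((varsWord Γ).map (fun p => (p.1, 3 * p.2 + 1)) ++
  (List.finRange A.numComps).flatMap fun j =>
    (varsOfWord Δ (A.compSrc j)).map fun n => (A.compTgt j, 3 * Nat.pair j.val n + 2))

theorem map_allVars (Δ : List A.ASrt) (Γ : List Sg.Srt) :
    (allVars A Δ Γ).map (fun p => (p.1, AVar.num p.1 p.2)) = allVarsWord A Δ Γ := by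
  unfold allVars allVarsWord
  simp only [List.map_append, List.map_map, List.map_flatMap, ← map_vars, ← map_varsOf]
  rfl

@[fun_prop] theorem primrec_allVarsWord {α : Type} [Primcodable α]
    {Δ : α → List A.ASrt} {Γ : α → List Sg.Srt} (hΔ : Primrec Δ) (hΓ : Primrec Γ) :
    Primrec fun a => allVarsWord A (Δ a) (Γ a) := by
  unfold allVarsWord
  fun_prop

/-- The context listing all artifact variables, local variables and reads. -/
abbrev flatCtx (A : ArtifactSetting Sg) (Δ : List A.ASrt) (Γ : List Sg.Srt) : List Sg.Srt :=
  (allVars A Δ Γ).map Sigma.fst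

theorem flatCtx_eq (Δ : List A.ASrt) (Γ : List Sg.Srt) :
    flatCtx A Δ Γ = (allVarsWord A Δ Γ).map Prod.fst := by
  rw [← map_allVars, List.map_map]
  rfl

/-- The number of an artifact variable, local variable or read as a variable of `flatCtx`. -/
def flatIdx (A : ArtifactSetting Sg) (Δ : List A.ASrt) (Γ : List Sg.Srt) (n : ℕ) : ℕ :=
  ((allVarsWord A Δ Γ).map Prod.snd).idxOf n

/-- The artifact variable, local variable or read with a given position in `flatCtx`. -/
def unflatIdx (A : ArtifactSetting Sg) (Δ : List A.ASrt) (Γ : List Sg.Srt) (n : ℕ) : ℕ :=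
  ((((allVarsWord A Δ Γ).map Prod.snd))[n]?).getD 0

@[fun_prop] theorem primrec_flatIdx {α : Type} [Primcodable α]
    {Δ : α → List A.ASrt} {Γ : α → List Sg.Srt} {n : α → ℕ} (hΔ : Primrec Δ) (hΓ : Primrec Γ)
    (hn : Primrec n) : Primrec fun a => flatIdx A (Δ a) (Γ a) (n a) := by
  unfold flatIdx
  fun_prop

@[fun_prop] theorem primrec_unflatIdx {α : Type} [Primcodable α]
    {Δ : α → List A.ASrt} {Γ : α → List Sg.Srt} {n : α → ℕ} (hΔ : Primrec Δ) (hΓ : Primrec Γ)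
    (hn : Primrec n) : Primrec fun a => unflatIdx A (Δ a) (Γ a) (n a) := by
  unfold unflatIdx
  fun_prop

theorem exists_flat {Δ : List A.ASrt} {Γ : List Sg.Srt} {s : Sg.Srt} (v : AVar A Δ Γ s) :
    ∃ x : Var (flatCtx A Δ Γ) s, getVar (allVars A Δ Γ) x = v ∧
      x.idx = flatIdx A Δ Γ (AVar.num s v) := by
  obtain ⟨x, hx, hi⟩ := exists_listed_var AVar.num_injective _ v (mem_allVars v)
  refine ⟨x, hx, ?_⟩
  rw [hi, flatIdx, ← map_allVars, List.map_map]
  rfl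

/-- Artifact variables, local variables and reads as variables of `flatCtx`. -/
noncomputable def flat {Δ : List A.ASrt} {Γ : List Sg.Srt} (s : Sg.Srt) (v : AVar A Δ Γ s) :
    Var (flatCtx A Δ Γ) s := (exists_flat v).choose

/-- Variables of `flatCtx` as artifact variables, local variables and reads. -/
def unflat {Δ : List A.ASrt} {Γ : List Sg.Srt} (s : Sg.Srt) (x : Var (flatCtx A Δ Γ) s) :
    AVar A Δ Γ s := getVar (allVars A Δ Γ) x

@[simp] theorem unflat_flat {Δ : List A.ASrt} {Γ : List Sg.Srt} (s : Sg.Srt)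
    (v : AVar A Δ Γ s) : unflat s (flat s v) = v := (exists_flat v).choose_spec.1

theorem idx_flat {Δ : List A.ASrt} {Γ : List Sg.Srt} (s : Sg.Srt) (v : AVar A Δ Γ s) :
    (flat s v).idx = flatIdx A Δ Γ (AVar.num s v) := (exists_flat v).choose_spec.2

theorem num_unflat {Δ : List A.ASrt} {Γ : List Sg.Srt} (s : Sg.Srt)
    (x : Var (flatCtx A Δ Γ) s) : AVar.num s (unflat s x) = unflatIdx A Δ Γ x.idx := by
  have := getElem?_getVar (allVars A Δ Γ) x
  rw [unflatIdx, ← map_allVars, List.map_map, List.getElem?_map, this]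
  rfl

/-! ### Renaming in the extended language -/

variable {Δ Δ' : List A.ASrt} {Γ Γ' : List Sg.Srt}

/-- Renaming of the individual variables in artifact variables, local variables and reads. -/
def AVar.ren (rA : ∀ E, Var Δ E → Var Δ' E) (rB : ∀ s, Var Γ s → Var Γ' s) :
    (s : Sg.Srt) → AVar A Δ Γ s → AVar A Δ' Γ' s
  | _, .art i => .art i
  | _, .loc v => .loc (rB _ v)
  | _, .read j e => .read j (rA _ e)

/-- Renaming of the individual variables in an atom. -/
def AAtom.ren (rA : ∀ E, Var Δ E → Var Δ' E) (rB : ∀ s, Var Γ s → Var Γ' s) :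
    AAtom A Δ Γ → AAtom A Δ' Γ'
  | .basicEq q => .basicEq (q.ren (AVar.ren rA rB))
  | .artEq E e e' => .artEq E (rA E e) (rA E e')

/-- Renaming of the individual variables in a quantifier-free formula. -/
def AQF.ren (rA : ∀ E, Var Δ E → Var Δ' E) (rB : ∀ s, Var Γ s → Var Γ' s)
    (φ : AQF A Δ Γ) : AQF A Δ' Γ' := φ.bind fun a => .atom (a.ren rA rB)

/-- Renaming of the individual variables in a term. -/
def ATerm.ren (rA : ∀ E, Var Δ E → Var Δ' E) (rB : ∀ s, Var Γ s → Var Γ' s) {s : Sg.Srt}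
    (t : ATerm A Δ Γ s) : ATerm A Δ' Γ' s := Term.ren (AVar.ren rA rB) t

theorem AVar.eval_ren {M : ExtStruct A} (st : State M) (δ : Env M.entries Δ')
    (ρ : Env M.db.carrier Γ') (rA : ∀ E, Var Δ E → Var Δ' E) (rB : ∀ s, Var Γ s → Var Γ' s)
    (s : Sg.Srt) (v : AVar A Δ Γ s) :
    AVar.eval st δ ρ s (AVar.ren rA rB s v) =
      AVar.eval st (fun E e => δ E (rA E e)) (fun s v => ρ s (rB s v)) s v := by
  cases v <;> rfl

theorem ATerm.eval_ren {M : ExtStruct A} (st : State M) (δ : Env M.entries Δ')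
    (ρ : Env M.db.carrier Γ') (rA : ∀ E, Var Δ E → Var Δ' E) (rB : ∀ s, Var Γ s → Var Γ' s)
    {s : Sg.Srt} (t : ATerm A Δ Γ s) :
    ATerm.eval st δ ρ (ATerm.ren rA rB t) =
      ATerm.eval st (fun E e => δ E (rA E e)) (fun s v => ρ s (rB s v)) t := by
  unfold ATerm.eval ATerm.ren
  rw [Term.eval_ren]
  congr 1
  funext s v
  exact AVar.eval_ren st δ ρ rA rB s v

theorem AQF.holds_ren {M : ExtStruct A} (st : State M) (δ : Env M.entries Δ')
    (ρ : Env M.db.carrier Γ') (rA : ∀ E, Var Δ E → Var Δ' E) (rB : ∀ s, Var Γ s → Var Γ' s)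
    (φ : AQF A Δ Γ) :
    AQF.Holds st δ ρ (AQF.ren rA rB φ) ↔
      AQF.Holds st (fun E e => δ E (rA E e)) (fun s v => ρ s (rB s v)) φ := by
  unfold AQF.Holds AQF.ren
  rw [BF.holds_bind]
  refine BF.holds_congr (fun a => ?_) φ
  cases a with
  | basicEq q =>
    show (q.ren _).Holds _ _ ↔ q.Holds _ _
    rw [EqAtom.holds_ren]
    have : (fun s v => AVar.eval st δ ρ s (AVar.ren rA rB s v)) =
        AVar.eval st (fun E e => δ E (rA E e)) (fun s v => ρ s (rB s v)) := by
      funext s v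
      exact AVar.eval_ren st δ ρ rA rB s v
    rw [this]
  | artEq E e e' => exact Iff.rfl

/-- Renaming of entries in the number of an artifact variable, local variable or read. -/
def renNum (r : ℕ → ℕ) (n : ℕ) : ℕ :=
  if n % 3 = 2 then 3 * Nat.pair (Nat.unpair (n / 3)).1 (r (Nat.unpair (n / 3)).2) + 2 else n

/-- Renaming of entries in the word of a quantifier-free formula. -/
def aqfWordRen (r : ℕ → ℕ) (w : List (Fin 4 ⊕ (EqWord Sg ⊕ (ℕ × ℕ)))) :
    List (Fin 4 ⊕ (EqWord Sg ⊕ (ℕ × ℕ))) :=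
  BF.wordBind (Sum.elim (fun q => [.inr (.inl (EqWord.ren (renNum r) q))])
    (fun p => [.inr (.inr (r p.1, r p.2))])) w

@[fun_prop] theorem primrec_renNum {α : Type} [Primcodable α] {r : α → ℕ → ℕ} {n : α → ℕ}
    (hr : Primrec fun p : α × ℕ => r p.1 p.2) (hn : Primrec n) :
    Primrec fun a => renNum (r a) (n a) := by
  unfold renNum
  have : Primrec fun a => r a (Nat.unpair (n a / 3)).2 :=
    hr.comp (g := fun a => (a, (Nat.unpair (n a / 3)).2)) (by fun_prop)
  fun_prop

@[fun_prop] theorem primrec_aqfWordRen {α : Type} [Primcodable α] {r : α → ℕ → ℕ}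
    {w : α → List (Fin 4 ⊕ (EqWord Sg ⊕ (ℕ × ℕ)))}
    (hr : Primrec fun p : α × ℕ => r p.1 p.2) (hw : Primrec w) :
    Primrec fun a => aqfWordRen (r a) (w a) := by
  unfold aqfWordRen
  have h1 : Primrec fun p : ((α × (EqWord Sg ⊕ (ℕ × ℕ))) × (ℕ × ℕ)) => r p.1.1 p.2.1 :=
    hr.comp (g := fun p : ((α × (EqWord Sg ⊕ (ℕ × ℕ))) × (ℕ × ℕ)) => (p.1.1, p.2.1)) (by fun_prop)
  have h2 : Primrec fun p : ((α × (EqWord Sg ⊕ (ℕ × ℕ))) × (ℕ × ℕ)) => r p.1.1 p.2.2 :=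
    hr.comp (g := fun p : ((α × (EqWord Sg ⊕ (ℕ × ℕ))) × (ℕ × ℕ)) => (p.1.1, p.2.2)) (by fun_prop)
  have h3 : Primrec fun p : ((((α × (EqWord Sg ⊕ (ℕ × ℕ))) × EqWord Sg) × ℕ) × ℕ) =>
      r p.1.1.1.1 p.2 :=
    hr.comp (g := fun p : ((((α × (EqWord Sg ⊕ (ℕ × ℕ))) × EqWord Sg) × ℕ) × ℕ) =>
      (p.1.1.1.1, p.2)) (by fun_prop)
  fun_prop

theorem AVar.num_ren {rA : ∀ E, Var Δ E → Var Δ' E} {rB : ∀ s, Var Γ s → Var Γ' s} {r : ℕ → ℕ}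
    (hA : ∀ E e, (rA E e).idx = r e.idx) (hB : ∀ s v, (rB s v).idx = v.idx) (s : Sg.Srt)
    (v : AVar A Δ Γ s) : AVar.num s (AVar.ren rA rB s v) = renNum r (AVar.num s v) := by
  cases v with
  | art i =>
    simp [AVar.ren, AVar.num, renNum]
  | loc v =>
    simp [AVar.ren, AVar.num, renNum, hB]
  | read j e =>
    have h1 : (3 * Nat.pair j.val e.idx + 2) % 3 = 2 := by omega
    have h2 : (3 * Nat.pair j.val e.idx + 2) / 3 = Nat.pair j.val e.idx := by omega
    simp [AVar.ren, AVar.num, renNum, hA, h1, h2]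

theorem AQF.word_ren {rA : ∀ E, Var Δ E → Var Δ' E} {rB : ∀ s, Var Γ s → Var Γ' s} {r : ℕ → ℕ}
    (hA : ∀ E e, (rA E e).idx = r e.idx) (hB : ∀ s v, (rB s v).idx = v.idx) (φ : AQF A Δ Γ) :
    (AQF.ren rA rB φ).word AAtom.word = aqfWordRen r (φ.word AAtom.word) := by
  refine BF.word_bind (fun a => ?_) φ
  cases a with
  | basicEq q =>
    simp [BF.word, AAtom.ren, AAtom.word, EqAtom.word_ren (AVar.num_ren hA hB)]
  | artEq E e e' => simp [BF.word, AAtom.ren, AAtom.word, hA]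

theorem ATerm.word_ren {rA : ∀ E, Var Δ E → Var Δ' E} {rB : ∀ s, Var Γ s → Var Γ' s} {r : ℕ → ℕ}
    (hA : ∀ E e, (rA E e).idx = r e.idx) (hB : ∀ s v, (rB s v).idx = v.idx) {s : Sg.Srt}
    (t : ATerm A Δ Γ s) :
    (ATerm.ren rA rB t).word AVar.num = TermWord.ren (renNum r) (Term.word AVar.num t) :=
  Term.word_ren (AVar.num_ren hA hB) t

/-! ### Resolving equations between entries -/

/-- Equations between entries are replaced by their truth values: true for the pairs in `P`. -/
def resolve (P : List (ℕ × ℕ)) (φ : AQF A Δ Γ) : QF Sg (AVar A Δ Γ) :=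
  φ.bind fun
    | .basicEq q => .atom q
    | .artEq _ e e' => if (e.idx, e'.idx) ∈ P then .top else .bot

theorem holds_resolve {M : ExtStruct A} (st : State M) (δ : Env M.entries Δ)
    (ρ : Env M.db.carrier Γ) (P : List (ℕ × ℕ))
    (hP : ∀ E (e e' : Var Δ E), (e.idx, e'.idx) ∈ P ↔ δ E e = δ E e') (φ : AQF A Δ Γ) :
    QF.Holds M.db (AVar.eval st δ ρ) (resolve P φ) ↔ AQF.Holds st δ ρ φ := by
  unfold QF.Holds resolve AQF.Holds
  rw [BF.holds_bind]
  refine BF.holds_congr (fun a => ?_) φ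
  cases a with
  | basicEq q => exact Iff.rfl
  | artEq E e e' =>
    show BF.Holds _ (if _ then _ else _) ↔ δ E e = δ E e'
    rw [← hP]
    split <;> simp_all [BF.Holds]

/-- Resolving equations between entries in words. -/
def resolveWord (P : List (ℕ × ℕ)) (w : List (Fin 4 ⊕ (EqWord Sg ⊕ (ℕ × ℕ)))) :
    List (Fin 4 ⊕ EqWord Sg) :=
  BF.wordBind (Sum.elim (fun q => [.inr q])
    (fun p => if p ∈ P then BF.topWord else [.inl 0])) w

theorem word_resolve (P : List (ℕ × ℕ)) (φ : AQF A Δ Γ) :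
    (resolve P φ).word (EqAtom.word AVar.num) = resolveWord P (φ.word AAtom.word) := by
  refine BF.word_bind (fun a => ?_) φ
  cases a with
  | basicEq q => rfl
  | artEq E e e' =>
    simp only [AAtom.word, Sum.elim_inr]
    split <;> rfl

@[fun_prop] theorem primrec_resolveWord {α : Type} [Primcodable α] {P : α → List (ℕ × ℕ)}
    {w : α → List (Fin 4 ⊕ (EqWord Sg ⊕ (ℕ × ℕ)))} (hP : Primrec P) (hw : Primrec w) :
    Primrec fun a => resolveWord (P a) (w a) := by
  unfold resolveWord
  fun_prop

end Extended

/-! ### Satisfiability of `φ ∧ ¬B` -/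

section Frontier

variable {Sg : DBSig} {A : ArtifactSetting Sg}

/-- State formulae as existential formulae. -/
def StateFormula.toExists (φ : StateFormula A) : ExistsFormula A := ⟨φ.arts, [], φ.matrix⟩

theorem StateFormula.holds_toExists {M : ExtStruct A} (st : State M) (φ : StateFormula A) :
    φ.toExists.Holds st ↔ φ.Holds st := Iff.rfl

/-- The instances of a quantifier-free formula by the entries listed in `R`. -/
def ground (R : List A.ASrt) {Δ : List A.ASrt} {Γ Γ' : List Sg.Srt}
    (rB : ∀ s, Var Γ s → Var Γ' s) (φ : AQF A Δ Γ) : AQF A R Γ' :=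
  .disj ((allEnvs R Δ).map fun g => AQF.ren g rB φ)

theorem holds_ground {R Δ : List A.ASrt} {Γ Γ' : List Sg.Srt}
    (rB : ∀ s, Var Γ s → Var Γ' s) (φ : AQF A Δ Γ) {M : ExtStruct A} (st : State M)
    (ε : Env M.entries R) (ρ : Env M.db.carrier Γ') :
    AQF.Holds st ε ρ (ground R rB φ) ↔ ∃ g : Env (Var R) Δ,
      AQF.Holds st (fun E e => ε E (g E e)) (fun s v => ρ s (rB s v)) φ := by
  unfold ground
  rw [AQF.Holds, BF.holds_disj]
  constructor
  · rintro ⟨_, hm, h⟩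
    obtain ⟨g, _, rfl⟩ := List.mem_map.1 hm
    exact ⟨g, (AQF.holds_ren ..).1 h⟩
  · rintro ⟨g, h⟩
    exact ⟨_, List.mem_map.2 ⟨g, mem_allEnvs g, rfl⟩, (AQF.holds_ren ..).2 h⟩

/-- The formula `φ ∧ ¬B` over the entries listed in `R`. -/
def frontierMatrix (φ : ExistsFormula A) (B : List (StateFormula A)) (R : List A.ASrt) :
    AQF A R φ.basics :=
  .and (ground R (fun _ v => v) φ.matrix)
    (.conj (B.map fun ψ => .not (ground R (fun _ v => v.elim0) ψ.matrix)))

theorem holds_frontierMatrix (φ : ExistsFormula A) (B : List (StateFormula A))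
    (R : List A.ASrt) {M : ExtStruct A} (st : State M)
    (ε : Env M.entries R) (ρ : Env M.db.carrier φ.basics) :
    AQF.Holds st ε ρ (frontierMatrix φ B R) ↔
      (∃ g : Env (Var R) φ.arts, AQF.Holds st (fun E e => ε E (g E e)) ρ φ.matrix) ∧
      ∀ ψ ∈ B, ¬ ∃ g : Env (Var R) ψ.arts,
        AQF.Holds st (fun E e => ε E (g E e)) Env.nil ψ.matrix := by
  have h1 := holds_ground (R := R) (fun _ v => v) φ.matrix st ε ρ
  have h2 := fun ψ : StateFormula A =>
    holds_ground (R := R) (fun _ v => v.elim0) ψ.matrix st ε ρ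
  unfold AQF.Holds at *
  simp only [frontierMatrix, BF.Holds, BF.holds_conj, List.mem_map, forall_exists_index, and_imp,
    forall_apply_eq_imp_iff₂, h1, h2]
  refine and_congr Iff.rfl (forall₂_congr fun ψ _ => not_congr (exists_congr fun g => ?_))
  rw [Env.eq_nil (fun s v => ρ s _)]

/-- The equations that hold between pairwise distinct entries. -/
def diag (R : List A.ASrt) : List (ℕ × ℕ) := (varsWord R).map fun p => (p.2, p.2)

theorem mem_diag {R : List A.ASrt} {E : A.ASrt} (e e' : Var R E) :
    (e.idx, e'.idx) ∈ diag R ↔ e = e' := by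
  unfold diag
  constructor
  · intro h
    obtain ⟨p, _, hp⟩ := List.mem_map.1 h
    rw [Prod.mk.injEq] at hp
    exact Var.ext_idx (hp.1.symm.trans hp.2)
  · rintro rfl
    refine List.mem_map.2 ⟨(E, e.idx), ?_, rfl⟩
    rw [← map_vars]
    exact List.mem_map.2 ⟨⟨E, e⟩, mem_vars e, rfl⟩

/-- The formula `φ ∧ ¬B` over pairwise distinct entries listed in `R`, as a formula of the DB
signature. -/
noncomputable def frontierOpen (φ : ExistsFormula A) (B : List (StateFormula A))
    (R : List A.ASrt) : OpenFml Sg :=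
  ⟨flatCtx A R φ.basics, QF.ren flat (resolve (diag R) (frontierMatrix φ B R))⟩

/-- The lists of entries that suffice for the satisfiability of `φ ∧ ¬B`. -/
def entryLists (A : ArtifactSetting Sg) (Δ : List A.ASrt) : List (List A.ASrt) :=
  (subs Δ).map fun R => R ++ List.finRange A.numArtSorts

theorem nonempty_var_of_mem {K : Type} {Γ : List K} {s : K} (h : s ∈ Γ) : Nonempty (Var Γ s) := by
  induction Γ with
  | nil => simp at h
  | cons u Γ ih =>
    rcases List.mem_cons.1 h with rfl | h
    · exact ⟨.zero⟩
    · exact (ih h).elim fun v => ⟨.succ v⟩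

/-- An assignment satisfying `frontierOpen` yields a state satisfying `φ ∧ ¬B`. -/
theorem exists_state_of_frontierOpen {φ : ExistsFormula A} {B : List (StateFormula A)}
    {R : List A.ASrt} (hR : R ∈ entryLists A φ.arts) (M : Struct Sg)
    (ρ : Env M.carrier (flatCtx A R φ.basics))
    (h : QF.Holds M ρ (frontierOpen φ B R).matrix) :
    ∃ (N : ExtStruct A), N.db = M ∧ ∃ st : State N, φ.Holds st ∧ ¬ ∃ ψ ∈ B, ψ.Holds st := by
  have hne : ∀ E, Nonempty (Var R E) := by
    obtain ⟨R', _, rfl⟩ := List.mem_map.1 hR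
    exact fun E => nonempty_var_of_mem (List.mem_append_right _ (List.mem_finRange E))
  let N : ExtStruct A := ⟨M, Var R, hne⟩
  let st : State N := ⟨fun i => ρ _ (flat _ (.art i)), fun j e => ρ _ (flat _ (.read j e))⟩
  let ρ' : Env N.db.carrier φ.basics := fun s v => ρ s (flat s (.loc v))
  have hev : (fun s v => ρ s (flat s v)) =
      AVar.eval (M := N) (Δ := R) (Γ := φ.basics) st (fun _ e => e) ρ' := by
    funext s v
    cases v <;> rfl
  have h := (QF.holds_ren M flat ρ _).1 h
  rw [hev] at h
  have h' := (holds_resolve (M := N) st (fun _ e => e) ρ' (diag R) (fun E e e' => mem_diag e e')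
    _).1 h
  obtain ⟨⟨g, hg⟩, hB⟩ := (holds_frontierMatrix φ B R st (fun _ e => e) ρ').1 h'
  refine ⟨N, rfl, st, ⟨g, ρ', hg⟩, ?_⟩
  rintro ⟨ψ, hψ, δ, ρψ, hh⟩
  refine hB ψ hψ ⟨δ, ?_⟩
  rwa [ρψ.eq_nil] at hh

theorem var_subsingleton_of_nodup {K : Type} {Γ : List K} (h : Γ.Nodup) {s : K} (v v' : Var Γ s) :
    v = v' := by
  refine Var.ext_idx ?_
  have h1 := v.getElem?_idx
  have h2 := v'.getElem?_idx
  have hlt := (List.getElem?_eq_some_iff.1 h1).1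
  exact (List.getElem?_inj hlt h).1 (h1.trans h2.symm)

/-- Finitely many entries are covered by an injective assignment to some list of entries. -/
theorem exists_entryList (M : ExtStruct A) {Δ : List A.ASrt} (δ : Env M.entries Δ) :
    ∃ R ∈ entryLists A Δ, ∃ ε : Env M.entries R, (∀ E, Function.Injective (ε E)) ∧
      ∃ g : Env (Var R) Δ, ∀ E e, ε E (g E e) = δ E e := by
  induction Δ with
  | nil =>
    refine ⟨List.finRange A.numArtSorts, by simp [entryLists, subs],
      fun E _ => (M.entries_nonempty E).some, fun E e e' _ => ?_, Env.nil,
      fun _ v => v.elim0⟩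
    exact var_subsingleton_of_nodup (List.nodup_finRange _) e e'
  | cons F Δ ih =>
    obtain ⟨R, hR, ε, hε, g, hg⟩ := ih fun E e => δ E (.succ e)
    obtain ⟨R', hR', rfl⟩ := List.mem_map.1 hR
    by_cases h : ∃ e, ε F e = δ F .zero
    · obtain ⟨e, he⟩ := h
      refine ⟨_, List.mem_map.2 ⟨R', ?_, rfl⟩, ε, hε, Env.cons e g, ?_⟩
      · rw [subs_cons]
        exact List.mem_append_left _ hR'
      · intro E v
        cases v with
        | zero => exact he
        | succ v => exact hg E v
    · refine ⟨_, List.mem_map.2 ⟨F :: R', ?_, rfl⟩, Env.cons (δ F .zero) ε, ?_,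
        Env.cons .zero (fun E v => .succ (g E v)), ?_⟩
      · rw [subs_cons]
        exact List.mem_append_right _ (List.mem_map_of_mem hR')
      · intro E v v' hv
        cases v with
        | zero => cases v' with
          | zero => rfl
          | succ v' => exact absurd ⟨v', hv.symm⟩ h
        | succ v => cases v' with
          | zero => exact absurd ⟨v, hv⟩ h
          | succ v' => exact congrArg _ (hε E hv)
      · intro E v
        cases v with
        | zero => rfl
        | succ v => exact hg E v

theorem exists_frontierOpen_of_state {φ : ExistsFormula A} {B : List (StateFormula A)}
    {M : ExtStruct A} (st : State M) (hφ : φ.Holds st) (hB : ¬ ∃ ψ ∈ B, ψ.Holds st) :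
    ∃ R ∈ entryLists A φ.arts, ∃ ρ : Env M.db.carrier (flatCtx A R φ.basics),
      QF.Holds M.db ρ (frontierOpen φ B R).matrix := by
  obtain ⟨δ, ρ, h⟩ := hφ
  obtain ⟨R, hR, ε, hε, g, hg⟩ := exists_entryList M δ
  refine ⟨R, hR, fun s x => AVar.eval st ε ρ s (unflat s x), ?_⟩
  refine (QF.holds_ren M.db flat _ _).2 ?_
  simp only [unflat_flat]
  refine (holds_resolve st ε ρ (diag R) (fun E e e' => ?_) _).2 ?_
  · rw [mem_diag]
    exact (hε E).eq_iff.symm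
  · rw [holds_frontierMatrix]
    refine ⟨⟨g, ?_⟩, fun ψ hψ => ?_⟩
    · have : (fun E e => ε E (g E e)) = δ := by
        funext E e
        exact hg E e
      rw [this]
      exact h
    · rintro ⟨g', hg'⟩
      exact hB ⟨ψ, hψ, _, _, hg'⟩

end Frontier

section FrontierSat

variable {D : DBSchema} {A : ArtifactSetting D.sig}

theorem exists_model_iff_sat_frontierOpen (φ : ExistsFormula A) (B : List (StateFormula A)) :
    (∃ M : ExtStruct A, D.IsModel M.db ∧ ∃ st : State M, φ.Holds st ∧ ¬ ∃ ψ ∈ B, ψ.Holds st) ↔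
      ∃ R ∈ entryLists A φ.arts, D.Sat (frontierOpen φ B R) := by
  constructor
  · rintro ⟨M, hM, st, hφ, hB⟩
    obtain ⟨R, hR, ρ, h⟩ := exists_frontierOpen_of_state st hφ hB
    exact ⟨R, hR, M.db, hM, ρ, h⟩
  · rintro ⟨R, hR, M, hM, ρ, h⟩
    obtain ⟨N, rfl, st, hst⟩ := exists_state_of_frontierOpen hR M ρ h
    exact ⟨N, hM, st, hst⟩

theorem exists_instance_of_exists_model (hfmp : D.FiniteModelProperty) (φ : ExistsFormula A)
    (B : List (StateFormula A))
    (h : ∃ M : ExtStruct A, D.IsModel M.db ∧ ∃ st : State M,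
      φ.Holds st ∧ ¬ ∃ ψ ∈ B, ψ.Holds st) :
    ∃ M : ExtStruct A, D.IsInstance M.db ∧ ∃ st : State M,
      φ.Holds st ∧ ¬ ∃ ψ ∈ B, ψ.Holds st := by
  obtain ⟨R, hR, hs⟩ := (exists_model_iff_sat_frontierOpen φ B).1 h
  obtain ⟨M, hM, ρ, h⟩ := hfmp _ hs
  obtain ⟨N, rfl, st, hst⟩ := exists_state_of_frontierOpen hR M ρ h
  exact ⟨N, hM, st, hst⟩

end FrontierSat

/-! ### The initial formula as a negated disjunction of state formulae -/

section Init

variable {D : DBSchema} (S : RAS D)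

/-- The state formulae whose negations make up the initial formula. -/
def RAS.initNeg : List (StateFormula S.setting) :=
  (List.finRange S.setting.numVars).map (fun i =>
    ⟨[], .not (.atom (.basicEq ⟨_, .var (.art i),
      (S.initX i).2 ▸ Term.const (S.initX i).1⟩))⟩) ++
  (List.finRange S.setting.numComps).map fun j =>
    ⟨[S.setting.compSrc j], .not (.atom (.basicEq ⟨_, .var (.read j .zero),
      (S.initA j).2 ▸ Term.const (S.initA j).1⟩))⟩

theorem Term.eval_cast_const {Sg : DBSig} {V : Sg.Srt → Type} (M : Struct Sg)
    (ρ : ∀ s, V s → M.carrier s) (c : Fin Sg.numConsts) {s : Sg.Srt} (h : Sg.constSort c = s) :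
    Term.eval M ρ (h ▸ Term.const c : Term Sg V s) = h ▸ M.const c := by
  subst h
  rfl

theorem RAS.init_iff {M : ExtStruct S.setting} (st : State M) :
    S.Init st ↔ ¬ ∃ ψ ∈ S.initNeg, ψ.Holds st := by
  unfold RAS.Init RAS.initNeg
  constructor
  · rintro ⟨hx, ha⟩ ⟨ψ, hψ, δ, ρ, h⟩
    rcases List.mem_append.1 hψ with hψ | hψ
    · obtain ⟨i, _, rfl⟩ := List.mem_map.1 hψ
      exact h ((hx i).trans (Term.eval_cast_const ..).symm)
    · obtain ⟨j, _, rfl⟩ := List.mem_map.1 hψ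
      exact h ((ha j _).trans (Term.eval_cast_const ..).symm)
  · intro h
    constructor
    · intro i
      by_contra hne
      refine h ⟨_, List.mem_append_left _ (List.mem_map.2 ⟨i, List.mem_finRange i, rfl⟩),
        Env.nil, Env.nil, fun heq => hne ?_⟩
      exact Eq.trans heq (Term.eval_cast_const ..)
    · intro j y
      by_contra hne
      refine h ⟨_, List.mem_append_right _ (List.mem_map.2 ⟨j, List.mem_finRange j, rfl⟩),
        Env.cons y Env.nil, Env.nil, fun heq => hne ?_⟩
      exact Eq.trans heq (Term.eval_cast_const ..)

theorem RAS.initSat_iff (φ : StateFormula S.setting) :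
    S.InitSat φ ↔ S.FrontierSat φ S.initNeg := by
  unfold RAS.InitSat RAS.FrontierSat
  simp only [RAS.init_iff, and_comm]

end Init

/-! ### The satisfiability tests are effective -/

section Effective

variable {Sg : DBSig} {A : ArtifactSetting Sg}

/-- Words for quantifier-free formulae of the extended language. -/
abbrev AQFWord (Sg : DBSig) : Type := List (Fin 4 ⊕ (EqWord Sg ⊕ (ℕ × ℕ)))

/-- The word of `ground`. -/
def groundWord (R Δ : List A.ASrt) (w : AQFWord Sg) : AQFWord Sg :=
  BF.disjWord ((allEnvsWord R Δ).map fun g => aqfWordRen (fun n => (g[n]?).getD 0) w)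

theorem word_ground (R : List A.ASrt) {Δ : List A.ASrt} {Γ Γ' : List Sg.Srt}
    (rB : ∀ s, Var Γ s → Var Γ' s) (hB : ∀ s v, (rB s v).idx = v.idx) (φ : AQF A Δ Γ) :
    (ground R rB φ).word AAtom.word = groundWord R Δ (φ.word AAtom.word) := by
  unfold ground groundWord
  rw [BF.word_disj, ← map_allEnvs, List.map_map]
  refine congrArg BF.disjWord (List.map_map.trans (List.map_congr_left fun g _ => ?_))
  exact AQF.word_ren (idx_env g) hB φ

@[fun_prop] theorem primrec_groundWord {α : Type} [Primcodable α] {R Δ : α → List A.ASrt}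
    {w : α → AQFWord Sg} (hR : Primrec R) (hΔ : Primrec Δ) (hw : Primrec w) :
    Primrec fun a => groundWord (R a) (Δ a) (w a) := by
  unfold groundWord
  fun_prop

/-- The word of `frontierOpen`. -/
def frontierOpenWord (φ : List A.ASrt × List Sg.Srt × AQFWord Sg)
    (B : List (List A.ASrt × AQFWord Sg)) (R : List A.ASrt) :
    List (Fin Sg.numSorts) × List (Fin 4 ⊕ EqWord Sg) :=
  ((allVarsWord A R φ.2.1).map Prod.fst, qfWordRen (flatIdx A R φ.2.1)
    (resolveWord (diag R) (.inl 2 :: (groundWord R φ.1 φ.2.2 ++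
      BF.conjWord (B.map fun b => .inl 1 :: groundWord R b.1 b.2)))))

theorem word_frontierOpen (φ : ExistsFormula A) (B : List (StateFormula A)) (R : List A.ASrt) :
    (frontierOpen φ B R).word = frontierOpenWord φ.word (B.map StateFormula.word) R := by
  refine Prod.ext (flatCtx_eq R φ.basics) ?_
  refine (QF.word_ren (num := AVar.num) (num' := fun _ v => Var.idx v) (rw := flatIdx A R φ.basics)
    (fun s v => idx_flat s v) _).trans (congrArg (qfWordRen (flatIdx A R φ.basics)) ?_)
  rw [word_resolve]
  congr 1
  simp only [frontierMatrix, BF.word, BF.word_conj, List.map_map]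
  rw [word_ground _ _ (fun _ _ => rfl)]
  congr 4
  funext ψ
  simp only [Function.comp_apply, BF.word, StateFormula.word]
  rw [word_ground _ _ (fun _ v => v.elim0)]

@[fun_prop] theorem primrec_frontierOpenWord {α : Type} [Primcodable α]
    {φ : α → List A.ASrt × List Sg.Srt × AQFWord Sg}
    {B : α → List (List A.ASrt × AQFWord Sg)} {R : α → List A.ASrt}
    (hφ : Primrec φ) (hB : Primrec B) (hR : Primrec R) :
    Primrec fun a => frontierOpenWord (φ a) (B a) (R a) := by
  unfold frontierOpenWord diag
  fun_prop

theorem RAS.frontierSat_decidable {D : DBSchema} (hdec : D.DecidableConstraintSat) (S : RAS D) :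
    EffectivelyDecidable
      (fun p : StateFormula S.setting × List (StateFormula S.setting) =>
        (p.1.word, p.2.map StateFormula.word))
      (fun p => S.FrontierSat p.1 p.2) := by
  classical
  obtain ⟨g, hg, hgs⟩ := hdec
  let f : (List S.setting.ASrt × AQFWord D.sig) × List (List S.setting.ASrt × AQFWord D.sig) →
      List (List (Fin D.sig.numSorts) × List (Fin 4 ⊕ EqWord D.sig)) := fun p =>
    (entryLists S.setting p.1.1).map fun R => frontierOpenWord (p.1.1, [], p.1.2) p.2 R
  have hf : Primrec f := by
    unfold f entryLists
    fun_prop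
  have hany : Primrec (fun l : List Bool => if true ∈ l then true else false) := by
    fun_prop
  refine ⟨_, hany.to_comp.comp ((computable_list_map hg).comp hf.to_comp), ?_⟩
  rintro ⟨φ, B⟩
  have key : S.FrontierSat φ B ↔ ∃ R ∈ entryLists S.setting φ.arts,
      D.Sat (frontierOpen φ.toExists B R) :=
    exists_model_iff_sat_frontierOpen φ.toExists B
  have hmem : true ∈ (f (φ.word, B.map StateFormula.word)).map g ↔ S.FrontierSat φ B := by
    rw [key]
    simp only [f, List.map_map, List.mem_map]
    refine exists_congr fun R => and_congr Iff.rfl ?_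
    have : frontierOpenWord (φ.word.1, [], φ.word.2) (B.map StateFormula.word) R =
        (frontierOpen φ.toExists B R).word := (word_frontierOpen φ.toExists B R).symm
    simp only [Function.comp_apply]
    rw [this, hgs]
    simp
  simp only [hmem]
  by_cases h : S.FrontierSat φ B <;> simp [h]

theorem RAS.initSat_decidable {D : DBSchema} (hdec : D.DecidableConstraintSat) (S : RAS D) :
    EffectivelyDecidable StateFormula.word S.InitSat := by
  classical
  obtain ⟨g, hg, hgs⟩ := S.frontierSat_decidable hdec
  have hf : Primrec fun w : List (Fin S.setting.numArtSorts) × AQFWord D.sig =>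
      (w, S.initNeg.map StateFormula.word) := by fun_prop
  refine ⟨_, hg.comp hf.to_comp, fun φ => ?_⟩
  have := hgs (φ, S.initNeg)
  rw [this]
  simp [S.initSat_iff]

end Effective

/-! ### Elimination of the quantified variables of basic sorts -/

section Elimination

variable {Sg : DBSig} {A : ArtifactSetting Sg}

/-- The well-sorted equations between entry variables, as pairs of positions. -/
def entryEqs (Δ : List A.ASrt) : List (ℕ × ℕ) :=
  (varsWord Δ).flatMap fun p => (varsOfWord Δ p.1).map fun n => (p.2, n)

/-- The well-sorted equations between entry variables. -/
def entryAtoms (Δ : List A.ASrt) : List (Σ E, Var Δ E × Var Δ E) :=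
  (vars Δ).flatMap fun p => (varsOf Δ p.1).map fun e => ⟨p.1, p.2, e⟩

theorem mem_entryAtoms {Δ : List A.ASrt} {E : A.ASrt} (e e' : Var Δ E) :
    (⟨E, e, e'⟩ : Σ E, Var Δ E × Var Δ E) ∈ entryAtoms Δ :=
  List.mem_flatMap.2 ⟨⟨E, e⟩, mem_vars e, List.mem_map.2 ⟨e', mem_varsOf e', rfl⟩⟩

theorem map_entryAtoms (Δ : List A.ASrt) :
    (entryAtoms Δ).map (fun q => (q.2.1.idx, q.2.2.idx)) = entryEqs Δ := by
  unfold entryAtoms entryEqs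
  simp only [List.map_flatMap, List.map_map, ← map_vars, ← map_varsOf, List.flatMap_map]
  rfl

/-- The formula saying that precisely the equations in `P` hold between entry variables. -/
def entryType (Δ : List A.ASrt) (P : List (ℕ × ℕ)) : AQF A Δ [] :=
  .conj ((entryAtoms Δ).map fun q =>
    if (q.2.1.idx, q.2.2.idx) ∈ P then .atom (.artEq q.1 q.2.1 q.2.2)
    else .not (.atom (.artEq q.1 q.2.1 q.2.2)))

theorem holds_entryType {Δ : List A.ASrt} (P : List (ℕ × ℕ)) {M : ExtStruct A} (st : State M)
    (δ : Env M.entries Δ) (ρ : Env M.db.carrier []) :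
    AQF.Holds st δ ρ (entryType Δ P) ↔
      ∀ E (e e' : Var Δ E), (e.idx, e'.idx) ∈ P ↔ δ E e = δ E e' := by
  unfold AQF.Holds entryType
  rw [BF.holds_conj]
  simp only [List.mem_map, forall_exists_index, and_imp, forall_apply_eq_imp_iff₂]
  constructor
  · intro h E e e'
    have := h _ (mem_entryAtoms e e')
    simp only at this
    split at this
    · rename_i hm
      exact ⟨fun _ => this, fun _ => hm⟩
    · rename_i hm
      exact ⟨fun h => absurd h hm, fun h => absurd h this⟩
  · rintro h ⟨E, e, e'⟩ _
    have := h E e e'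
    simp only
    split
    · rename_i hm
      exact this.1 hm
    · rename_i hm
      exact fun h => hm (this.2 h)

theorem exists_entryType {Δ : List A.ASrt} {M : ExtStruct A} (δ : Env M.entries Δ) :
    ∃ P ∈ subs (entryEqs Δ), ∀ E (e e' : Var Δ E), (e.idx, e'.idx) ∈ P ↔ δ E e = δ E e' := by
  classical
  refine ⟨((entryAtoms Δ).filter fun q => δ q.1 q.2.1 = δ q.1 q.2.2).map
    (fun q => (q.2.1.idx, q.2.2.idx)), ?_, fun E e e' => ?_⟩
  · rw [← map_entryAtoms, ← map_subs]
    exact List.mem_map_of_mem (filter_mem_subs _ _)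
  · constructor
    · intro h
      obtain ⟨⟨F, f, f'⟩, hq, hp⟩ := List.mem_map.1 h
      have hq := (List.mem_filter.1 hq).2
      simp only [Prod.mk.injEq] at hp
      have := Var.sigma_ext f e hp.1
      cases this
      obtain rfl := Var.ext_idx hp.2
      simpa using hq
    · intro h
      exact List.mem_map.2 ⟨⟨E, e, e'⟩, List.mem_filter.2 ⟨mem_entryAtoms e e', by simpa using h⟩,
        rfl⟩

/-- Artifact variables and reads become free variables, local variables become bound ones. -/
noncomputable def split {Δ : List A.ASrt} {Γ : List Sg.Srt} :
    (s : Sg.Srt) → AVar A Δ Γ s → Var (flatCtx A Δ []) s ⊕ Var Γ s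
  | _, .art i => .inl (flat _ (.art i))
  | _, .loc v => .inr v
  | _, .read j e => .inl (flat _ (.read j e))

/-- The existential formula of the DB signature obtained by resolving the equations between
entry variables according to `P`. -/
noncomputable def resolvedExFml (φ : ExistsFormula A) (P : List (ℕ × ℕ)) : ExFml Sg :=
  ⟨flatCtx A φ.arts [], φ.basics, QF.ren split (resolve P φ.matrix)⟩

theorem holds_resolvedExFml (φ : ExistsFormula A) (P : List (ℕ × ℕ)) {M : ExtStruct A}
    (st : State M) (δ : Env M.entries φ.arts)
    (hP : ∀ E (e e' : Var φ.arts E), (e.idx, e'.idx) ∈ P ↔ δ E e = δ E e') :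
    (resolvedExFml φ P).Holds M.db (fun s x => AVar.eval st δ Env.nil s (unflat s x)) ↔
      ∃ ρ : Env M.db.carrier φ.basics, AQF.Holds st δ ρ φ.matrix := by
  refine exists_congr fun σ => ?_
  refine (QF.holds_ren M.db split _ _).trans ?_
  have : (fun s v => Sum.elim (fun x => AVar.eval st δ Env.nil s (unflat s x)) (σ s) (split s v)) =
      AVar.eval st δ σ := by
    funext s v
    cases v with
    | art i => simp only [split, Sum.elim_inl, unflat_flat]; rfl
    | loc v => rfl
    | read j e => simp only [split, Sum.elim_inl, unflat_flat]; rfl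
  exact (iff_of_eq (congrArg (fun ρ => QF.Holds M.db ρ (resolve P φ.matrix)) this)).trans
    (holds_resolve st δ σ P hP φ.matrix)

/-- Formulae of the DB signature over `flatCtx` as formulae of the extended language. -/
def unflatten {Δ : List A.ASrt} (χ : QF Sg (Var (flatCtx A Δ []))) : AQF A Δ [] :=
  χ.bind fun q => .atom (.basicEq (q.ren unflat))

theorem holds_unflatten {Δ : List A.ASrt} (χ : QF Sg (Var (flatCtx A Δ []))) {M : ExtStruct A}
    (st : State M) (δ : Env M.entries Δ) (ρ : Env M.db.carrier []) :
    AQF.Holds st δ ρ (unflatten χ) ↔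
      QF.Holds M.db (fun s x => AVar.eval st δ ρ s (unflat s x)) χ := by
  unfold AQF.Holds unflatten QF.Holds
  rw [BF.holds_bind]
  exact BF.holds_congr (fun q => EqAtom.holds_ren M.db unflat _ q) χ

/-- Quantifier elimination in existential formulae of the extended language, given quantifier
elimination in existential formulae of the DB signature. -/
noncomputable def stateQE (qe : ∀ φ : ExFml Sg, QF Sg (Var φ.free)) (φ : ExistsFormula A) :
    StateFormula A :=
  ⟨φ.arts, .disj ((subs (entryEqs φ.arts)).map fun P =>
    .and (entryType φ.arts P) (unflatten (qe (resolvedExFml φ P))))⟩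

theorem holds_stateQE {Ts : Set (Fml Sg [])} (qe : ∀ φ : ExFml Sg, QF Sg (Var φ.free))
    (hqe : ∀ φ M, IsModelOf Ts M → ∀ ρ : Env M.carrier φ.free,
      φ.Holds M ρ ↔ QF.Holds M ρ (qe φ))
    (φ : ExistsFormula A) {M : ExtStruct A} (hM : IsModelOf Ts M.db) (st : State M) :
    (stateQE qe φ).Holds st ↔ φ.Holds st := by
  have key : ∀ (δ : Env M.entries φ.arts) (P : List (ℕ × ℕ)),
      (∀ E (e e' : Var φ.arts E), (e.idx, e'.idx) ∈ P ↔ δ E e = δ E e') →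
      (AQF.Holds st δ Env.nil (unflatten (qe (resolvedExFml φ P))) ↔
        ∃ ρ : Env M.db.carrier φ.basics, AQF.Holds st δ ρ φ.matrix) := by
    intro δ P hP
    refine (holds_unflatten _ st δ Env.nil).trans ?_
    exact (hqe (resolvedExFml φ P) M.db hM _).symm.trans (holds_resolvedExFml φ P st δ hP)
  constructor
  · rintro ⟨δ, ρ, h⟩
    obtain ⟨_, hm, h⟩ := (BF.holds_disj _ _).1 h
    obtain ⟨P, _, rfl⟩ := List.mem_map.1 hm
    rw [ρ.eq_nil] at h
    exact ⟨δ, (key δ P ((holds_entryType P st δ Env.nil).1 h.1)).1 h.2⟩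
  · rintro ⟨δ, h⟩
    obtain ⟨P, hP, hδ⟩ := exists_entryType δ
    refine ⟨δ, Env.nil, (BF.holds_disj _ _).2 ⟨_, List.mem_map.2 ⟨P, hP, rfl⟩, ?_, ?_⟩⟩
    · exact (holds_entryType P st δ Env.nil).2 hδ
    · exact (key δ P hδ).2 h

/-! ### Elimination is effective -/

/-- The word of `entryType`. -/
def entryTypeWord (Δ : List A.ASrt) (P : List (ℕ × ℕ)) : AQFWord Sg :=
  BF.conjWord ((entryEqs Δ).map fun q =>
    if q ∈ P then [.inr (.inr q)] else [.inl 1, .inr (.inr q)])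

theorem word_entryType (Δ : List A.ASrt) (P : List (ℕ × ℕ)) :
    (entryType Δ P).word AAtom.word = entryTypeWord Δ P := by
  unfold entryType entryTypeWord
  rw [BF.word_conj, ← map_entryAtoms, List.map_map, List.map_map]
  refine congrArg BF.conjWord (List.map_congr_left fun q _ => ?_)
  simp only [Function.comp_apply]
  split <;> rfl

@[fun_prop] theorem primrec_entryEqs {α : Type} [Primcodable α] {Δ : α → List A.ASrt}
    (hΔ : Primrec Δ) : Primrec fun a => entryEqs (Δ a) := by
  unfold entryEqs
  fun_prop

@[fun_prop] theorem primrec_entryTypeWord {α : Type} [Primcodable α] {Δ : α → List A.ASrt}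
    {P : α → List (ℕ × ℕ)} (hΔ : Primrec Δ) (hP : Primrec P) :
    Primrec fun a => (entryTypeWord (Δ a) (P a) : AQFWord Sg) := by
  unfold entryTypeWord
  fun_prop

/-- The effect of `split` on numbers of variables. -/
def splitNum (A : ArtifactSetting Sg) (Δ : List A.ASrt) (n : ℕ) : ℕ :=
  if n % 3 = 1 then 2 * (n / 3) + 1 else 2 * flatIdx A Δ [] n

@[fun_prop] theorem primrec_splitNum {α : Type} [Primcodable α] {Δ : α → List A.ASrt}
    {n : α → ℕ} (hΔ : Primrec Δ) (hn : Primrec n) :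
    Primrec fun a => splitNum A (Δ a) (n a) := by
  unfold splitNum
  fun_prop

theorem num_split {Δ : List A.ASrt} {Γ : List Sg.Srt} (s : Sg.Srt) (v : AVar A Δ Γ s) :
    Sum.elim (fun u : Var (flatCtx A Δ []) s => 2 * u.idx) (fun u : Var Γ s => 2 * u.idx + 1)
      (split s v) = splitNum A Δ (AVar.num s v) := by
  cases v with
  | art i =>
    have h : ¬ 3 * i.val % 3 = 1 := by omega
    simp only [split, Sum.elim_inl, idx_flat, splitNum, AVar.num]
    exact (if_neg h).symm
  | loc v =>
    have h : (3 * v.idx + 1) % 3 = 1 := by omega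
    have h' : (3 * v.idx + 1) / 3 = v.idx := by omega
    simp only [split, Sum.elim_inr, splitNum, AVar.num, if_pos h, h']
  | read j e =>
    have h : ¬ (3 * Nat.pair j.val e.idx + 2) % 3 = 1 := by omega
    simp only [split, Sum.elim_inl, idx_flat, splitNum, AVar.num]
    exact (if_neg h).symm

/-- The word of `resolvedExFml`. -/
def resolvedExFmlWord (w : List A.ASrt × List Sg.Srt × AQFWord Sg) (P : List (ℕ × ℕ)) :
    List (Fin Sg.numSorts) × List (Fin Sg.numSorts) × List (Fin 4 ⊕ EqWord Sg) :=
  ((allVarsWord A w.1 []).map Prod.fst, w.2.1,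
    qfWordRen (splitNum A w.1) (resolveWord P w.2.2))

theorem word_resolvedExFml (φ : ExistsFormula A) (P : List (ℕ × ℕ)) :
    (resolvedExFml φ P).word = resolvedExFmlWord φ.word P := by
  refine Prod.ext (flatCtx_eq φ.arts []) (Prod.ext rfl ?_)
  refine (QF.word_ren (num := AVar.num) (num' := fun s v =>
    Sum.elim (fun u : Var (flatCtx A φ.arts []) s => 2 * u.idx)
      (fun u : Var φ.basics s => 2 * u.idx + 1) v) (rw := splitNum A φ.arts)
    (fun s v => num_split s v) _).trans (congrArg (qfWordRen (splitNum A φ.arts)) ?_)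
  exact word_resolve P φ.matrix

@[fun_prop] theorem primrec_resolvedExFmlWord {α : Type} [Primcodable α]
    {w : α → List A.ASrt × List Sg.Srt × AQFWord Sg} {P : α → List (ℕ × ℕ)}
    (hw : Primrec w) (hP : Primrec P) :
    Primrec fun a => resolvedExFmlWord (w a) (P a) := by
  unfold resolvedExFmlWord
  fun_prop

/-- The word of `unflatten`. -/
def unflattenWord (Δ : List A.ASrt) (w : List (Fin 4 ⊕ EqWord Sg)) : AQFWord Sg :=
  BF.wordBind (fun q => [.inr (.inl (EqWord.ren (unflatIdx A Δ []) q))]) w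

theorem word_unflatten {Δ : List A.ASrt} (χ : QF Sg (Var (flatCtx A Δ []))) :
    (unflatten χ).word AAtom.word =
      unflattenWord Δ (χ.word (EqAtom.word fun _ v => v.idx)) := by
  refine BF.word_bind (fun q => ?_) χ
  simp only [BF.word, AAtom.word]
  rw [EqAtom.word_ren (num := fun _ v => Var.idx v) (rw := unflatIdx A Δ []) num_unflat]

@[fun_prop] theorem primrec_unflattenWord {α : Type} [Primcodable α] {Δ : α → List A.ASrt}
    {w : α → List (Fin 4 ⊕ EqWord Sg)} (hΔ : Primrec Δ) (hw : Primrec w) :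
    Primrec fun a => unflattenWord (Δ a) (w a) := by
  unfold unflattenWord
  fun_prop

theorem stateQE_effective (A : ArtifactSetting Sg) (qe : ∀ φ : ExFml Sg, QF Sg (Var φ.free))
    (heff : Effective ExFml.word (fun φ => OpenFml.word ⟨φ.free, qe φ⟩)) :
    Effective ExistsFormula.word (fun φ : ExistsFormula A => (stateQE qe φ).word) := by
  obtain ⟨g, hg, hgs⟩ := heff
  let inp : List A.ASrt × List Sg.Srt × AQFWord Sg →
      List ((List A.ASrt × List (ℕ × ℕ)) ×
        (List (Fin Sg.numSorts) × List (Fin Sg.numSorts) × List (Fin 4 ⊕ EqWord Sg))) := fun w =>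
    (subs (entryEqs w.1)).map fun P => ((w.1, P), resolvedExFmlWord w P)
  have hinp : Primrec inp := by
    unfold inp
    fun_prop
  let out : (List A.ASrt × List (ℕ × ℕ)) ×
      (List (Fin Sg.numSorts) × List (Fin 4 ⊕ EqWord Sg)) → AQFWord Sg := fun p =>
    .inl 2 :: (entryTypeWord p.1.1 p.1.2 ++ unflattenWord p.1.1 p.2.2)
  have hout : Primrec out := by
    unfold out
    fun_prop
  have hstep : Computable fun p : (List A.ASrt × List (ℕ × ℕ)) ×
      (List (Fin Sg.numSorts) × List (Fin Sg.numSorts) × List (Fin 4 ⊕ EqWord Sg)) =>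
      out (p.1, g p.2) :=
    hout.to_comp.comp (Computable.fst.pair (hg.comp Computable.snd))
  have hdisj : Primrec fun l : List (AQFWord Sg) => BF.disjWord l := by fun_prop
  have hfst : Primrec fun w : List A.ASrt × List Sg.Srt × AQFWord Sg => w.1 := by fun_prop
  refine ⟨_, hfst.to_comp.pair
    (hdisj.to_comp.comp ((computable_list_map hstep).comp hinp.to_comp)), fun φ => ?_⟩
  refine Prod.ext rfl ?_
  unfold stateQE StateFormula.word
  simp only [BF.word_disj, inp, List.map_map]
  refine congrArg BF.disjWord (List.map_congr_left fun P _ => ?_)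
  simp only [Function.comp_apply, out, BF.word, word_entryType]
  rw [← word_resolvedExFml, hgs]
  exact congrArg (fun w => Sum.inl 2 :: (entryTypeWord φ.arts P ++ w))
    (word_unflatten (qe (resolvedExFml φ P))).symm

end Elimination

/-! ### Concatenation of contexts -/

section Append

variable {K : Type}

/-- Variables of the left part of a concatenated context. -/
def Var.inl {Γ Γ' : List K} : (s : K) → Var Γ s → Var (Γ ++ Γ') s
  | _, .zero => .zero
  | _, .succ v => .succ (v.inl _)

/-- Variables of the right part of a concatenated context. -/
def Var.inr {Γ' : List K} : (Γ : List K) → (s : K) → Var Γ' s → Var (Γ ++ Γ') s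
  | [], _, v => v
  | _ :: Γ, s, v => .succ (Var.inr Γ s v)

theorem Var.idx_inl {Γ Γ' : List K} {s : K} (v : Var Γ s) :
    (Var.inl (Γ' := Γ') s v).idx = v.idx := by
  induction v with
  | zero => rfl
  | succ v ih => exact congrArg (· + 1) ih

theorem Var.idx_inr {Γ Γ' : List K} {s : K} (v : Var Γ' s) :
    (Var.inr Γ s v).idx = Γ.length + v.idx := by
  induction Γ with
  | nil => exact (Nat.zero_add _).symm
  | cons u Γ ih =>
    show (Var.inr Γ s v).idx + 1 = _
    rw [ih, List.length_cons]
    omega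

/-- Assignments to a concatenated context. -/
def Env.append {C : K → Type} : {Γ Γ' : List K} → Env C Γ → Env C Γ' → Env C (Γ ++ Γ')
  | [], _, _, ρ' => ρ'
  | _ :: _, _, ρ, ρ' => Env.cons (ρ _ .zero) (Env.append (fun s v => ρ s (.succ v)) ρ')

theorem Env.append_inl {C : K → Type} {Γ Γ' : List K} (ρ : Env C Γ) (ρ' : Env C Γ') :
    (fun s v => Env.append ρ ρ' s (Var.inl s v)) = ρ := by
  funext s v
  induction v with
  | zero => rfl
  | succ v ih => exact ih (fun s v => ρ s (.succ v))

theorem Env.append_inr {C : K → Type} {Γ Γ' : List K} (ρ : Env C Γ) (ρ' : Env C Γ') :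
    (fun s v => Env.append ρ ρ' s (Var.inr Γ s v)) = ρ' := by
  funext s v
  induction Γ with
  | nil => rfl
  | cons u Γ ih => exact ih (fun s v => ρ s (.succ v))

/-- Lifting of a renaming to one more variable. -/
def liftRen {Γ Γ' : List K} {u : K} (r : ∀ s, Var Γ s → Var Γ' s) :
    (s : K) → Var (u :: Γ) s → Var (u :: Γ') s
  | _, .zero => .zero
  | _, .succ v => .succ (r _ v)

theorem Env.cons_liftRen {C : K → Type} {Γ Γ' : List K} {u : K} (r : ∀ s, Var Γ s → Var Γ' s)
    (b : C u) (ρ : Env C Γ') :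
    (fun s v => Env.cons b ρ s (liftRen r s v)) = Env.cons b fun s v => ρ s (r s v) := by
  funext s v
  cases v <;> rfl

end Append

/-! ### Case-defined functions -/

section CaseFun

variable {D : DBSchema} {A : ArtifactSetting D.sig} {Δ Δ' : List A.ASrt} {Γ Γ' : List D.sig.Srt}
  {s : D.sig.Srt}

/-- Renaming in a case-defined function. -/
def CaseFun.ren (rA : ∀ E, Var Δ E → Var Δ' E) (rB : ∀ s, Var Γ s → Var Γ' s)
    (F : CaseFun A Δ Γ s) : CaseFun A Δ' Γ' s :=
  ⟨F.cases.map fun p => (AQF.ren rA rB p.1, ATerm.ren rA rB p.2)⟩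

theorem CaseFun.hasValue_ren (rA : ∀ E, Var Δ E → Var Δ' E) (rB : ∀ s, Var Γ s → Var Γ' s)
    (F : CaseFun A Δ Γ s) {M : ExtStruct A} (st : State M) (δ : Env M.entries Δ')
    (ρ : Env M.db.carrier Γ') (b : M.db.carrier s) :
    (F.ren rA rB).HasValue st δ ρ b ↔
      F.HasValue st (fun E e => δ E (rA E e)) (fun s v => ρ s (rB s v)) b := by
  simp only [CaseFun.HasValue, CaseFun.ren, List.mem_map, forall_exists_index, and_imp,
    forall_apply_eq_imp_iff₂, AQF.holds_ren, ATerm.eval_ren]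

theorem CaseFun.IsPartition.ren {F : CaseFun A Δ Γ s} (h : F.IsPartition (D := D))
    (rA : ∀ E, Var Δ E → Var Δ' E) (rB : ∀ s, Var Γ s → Var Γ' s) :
    (F.ren rA rB).IsPartition (D := D) := by
  intro M hM st δ ρ
  obtain ⟨⟨p, hp, hκ⟩, hpw⟩ := h M hM st (fun E e => δ E (rA E e)) (fun s v => ρ s (rB s v))
  constructor
  · exact ⟨_, List.mem_map_of_mem hp, (AQF.holds_ren ..).2 hκ⟩
  · refine List.pairwise_map.2 (hpw.imp fun {p q} hpq => ?_)
    rw [AQF.holds_ren, AQF.holds_ren]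
    exact hpq

/-- The value of a case-defined function is the value of the term of some case that applies. -/
theorem CaseFun.IsPartition.hasValue_iff {F : CaseFun A Δ Γ s} (h : F.IsPartition (D := D))
    {M : ExtStruct A} (hM : D.IsModel M.db) (st : State M) (δ : Env M.entries Δ)
    (ρ : Env M.db.carrier Γ) (b : M.db.carrier s) :
    F.HasValue st δ ρ b ↔
      ∃ p ∈ F.cases, AQF.Holds st δ ρ p.1 ∧ b = ATerm.eval st δ ρ p.2 := by
  classical
  obtain ⟨⟨p, hp, hκ⟩, hpw⟩ := h M hM st δ ρ
  have huniq : ∀ q ∈ F.cases, ∀ q' ∈ F.cases, AQF.Holds st δ ρ q.1 → AQF.Holds st δ ρ q'.1 →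
      q = q' := by
    intro q hq q' hq' h1 h2
    by_contra hne
    have : Std.Symm fun p q : AQF A Δ Γ × ATerm A Δ Γ s =>
        ¬ (AQF.Holds st δ ρ p.1 ∧ AQF.Holds st δ ρ q.1) := ⟨fun _ _ h h' => h h'.symm⟩
    exact hpw.forall hq hq' hne ⟨h1, h2⟩
  constructor
  · exact fun hv => ⟨p, hp, hκ, hv p hp hκ⟩
  · rintro ⟨q, hq, hκq, rfl⟩ q' hq' hκq'
    rw [huniq q hq q' hq' hκq hκq']

theorem CaseFun.IsPartition.exists_value {F : CaseFun A Δ Γ s} (h : F.IsPartition (D := D))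
    {M : ExtStruct A} (hM : D.IsModel M.db) (st : State M) (δ : Env M.entries Δ)
    (ρ : Env M.db.carrier Γ) : ∃ b, F.HasValue st δ ρ b := by
  obtain ⟨⟨p, hp, hκ⟩, _⟩ := h M hM st δ ρ
  exact ⟨_, (h.hasValue_iff hM st δ ρ _).2 ⟨p, hp, hκ, rfl⟩⟩

theorem CaseFun.IsPartition.value_unique {F : CaseFun A Δ Γ s} (h : F.IsPartition (D := D))
    {M : ExtStruct A} (hM : D.IsModel M.db) {st : State M} {δ : Env M.entries Δ}
    {ρ : Env M.db.carrier Γ} {b b' : M.db.carrier s} (hb : F.HasValue st δ ρ b)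
    (hb' : F.HasValue st δ ρ b') : b = b' := by
  obtain ⟨⟨p, hp, hκ⟩, _⟩ := h M hM st δ ρ
  exact (hb p hp hκ).trans (hb' p hp hκ).symm

end CaseFun

/-! ### Transitions over a common context -/

/-- Transition formulae whose quantified variables are listed in given contexts. -/
structure Move (D : DBSchema) (A : ArtifactSetting D.sig) (Δ : List A.ASrt)
    (Γ : List D.sig.Srt) where
  guard : AQF A Δ Γ
  updX : ∀ i, CaseFun A Δ Γ (A.varSort i)
  updA : ∀ j, CaseFun A (A.compSrc j :: Δ) Γ (A.compTgt j)
  updX_partition : ∀ i, (updX i).IsPartition (D := D)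
  updA_partition : ∀ j, (updA j).IsPartition (D := D)

section Move

variable {D : DBSchema} {A : ArtifactSetting D.sig} {Δ Δ' : List A.ASrt} {Γ Γ' : List D.sig.Srt}

/-- Truth of a transition formula on a pair of states, for given values of the quantified
variables. -/
def Move.HoldsAt (m : Move D A Δ Γ) {M : ExtStruct A} (st st' : State M) (δ : Env M.entries Δ)
    (ρ : Env M.db.carrier Γ) : Prop :=
  AQF.Holds st δ ρ m.guard ∧
    (∀ i, (m.updX i).HasValue st δ ρ (st'.x i)) ∧
    (∀ j (y : M.entries (A.compSrc j)), (m.updA j).HasValue st (Env.cons y δ) ρ (st'.a j y))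

/-- Truth of a transition formula on a pair of states. -/
def Move.Holds (m : Move D A Δ Γ) {M : ExtStruct A} (st st' : State M) : Prop :=
  ∃ δ ρ, m.HoldsAt st st' δ ρ

/-- A transition as a transition over its own context. -/
def Transition.toMove (t : Transition D A) : Move D A t.arts t.basics :=
  ⟨t.guard, t.updX, t.updA, t.updX_partition, t.updA_partition⟩

/-- Renaming of the quantified variables of a transition formula. -/
def Move.ren (rA : ∀ E, Var Δ E → Var Δ' E) (rB : ∀ s, Var Γ s → Var Γ' s)
    (m : Move D A Δ Γ) : Move D A Δ' Γ' where
  guard := AQF.ren rA rB m.guard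
  updX i := (m.updX i).ren rA rB
  updA j := (m.updA j).ren (liftRen rA) rB
  updX_partition i := (m.updX_partition i).ren rA rB
  updA_partition j := (m.updA_partition j).ren (liftRen rA) rB

theorem Move.holdsAt_ren (rA : ∀ E, Var Δ E → Var Δ' E) (rB : ∀ s, Var Γ s → Var Γ' s)
    (m : Move D A Δ Γ) {M : ExtStruct A} (st st' : State M) (δ : Env M.entries Δ')
    (ρ : Env M.db.carrier Γ') :
    (m.ren rA rB).HoldsAt st st' δ ρ ↔
      m.HoldsAt st st' (fun E e => δ E (rA E e)) (fun s v => ρ s (rB s v)) := by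
  unfold Move.HoldsAt Move.ren
  simp only [AQF.holds_ren, CaseFun.hasValue_ren, Env.cons_liftRen]

theorem Move.holds_ren_inl (m : Move D A Δ Γ) {M : ExtStruct A} (st st' : State M) :
    (m.ren (Var.inl (Γ' := Δ')) (Var.inl (Γ' := Γ'))).Holds st st' ↔ m.Holds st st' := by
  constructor
  · rintro ⟨δ, ρ, h⟩
    exact ⟨_, _, (m.holdsAt_ren _ _ st st' δ ρ).1 h⟩
  · rintro ⟨δ, ρ, h⟩
    let δ' : Env M.entries Δ' := fun E _ => (M.entries_nonempty E).some
    let ρ' : Env M.db.carrier Γ' := fun s _ => (M.db.nonempty s).some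
    refine ⟨δ.append δ', ρ.append ρ', (m.holdsAt_ren _ _ st st' _ _).2 ?_⟩
    rwa [Env.append_inl, Env.append_inl]

theorem Move.holds_ren_inr (m : Move D A Δ Γ) {M : ExtStruct A} (st st' : State M) :
    (m.ren (Var.inr Δ') (Var.inr Γ')).Holds st st' ↔ m.Holds st st' := by
  constructor
  · rintro ⟨δ, ρ, h⟩
    exact ⟨_, _, (m.holdsAt_ren _ _ st st' δ ρ).1 h⟩
  · rintro ⟨δ, ρ, h⟩
    let δ' : Env M.entries Δ' := fun E _ => (M.entries_nonempty E).some
    let ρ' : Env M.db.carrier Γ' := fun s _ => (M.db.nonempty s).some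
    refine ⟨δ'.append δ, ρ'.append ρ, (m.holdsAt_ren _ _ st st' _ _).2 ?_⟩
    rwa [Env.append_inr, Env.append_inr]

theorem exists_moves (l : List (Transition D A)) :
    ∃ (Δ : List A.ASrt) (Γ : List D.sig.Srt) (ms : List (Move D A Δ Γ)),
      ∀ (M : ExtStruct A) (st st' : State M),
        (∃ t ∈ l, t.Holds st st') ↔ ∃ m ∈ ms, m.Holds st st' := by
  induction l with
  | nil => exact ⟨[], [], [], by simp⟩
  | cons t l ih =>
    obtain ⟨Δ, Γ, ms, h⟩ := ih
    refine ⟨t.arts ++ Δ, t.basics ++ Γ, t.toMove.ren Var.inl Var.inl ::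
      ms.map (Move.ren (Var.inr _) (Var.inr _)), fun M st st' => ?_⟩
    simp only [List.mem_cons, exists_eq_or_imp, List.mem_map, exists_exists_and_eq_and,
      Move.holds_ren_inl, Move.holds_ren_inr, h]
    exact Iff.rfl

/-! ### Preimages -/

/-- The cases for the value of an artifact variable, local variable or read after a transition. -/
def Move.varCases (m : Move D A Δ Γ) {Δ' : List A.ASrt} {Γ' : List D.sig.Srt} :
    (s : D.sig.Srt) → AVar A Δ' Γ' s →
      List (AQF A (Δ ++ Δ') (Γ ++ Γ') × ATerm A (Δ ++ Δ') (Γ ++ Γ') s)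
  | _, .art i => ((m.updX i).ren Var.inl Var.inl).cases
  | _, .loc v => [(.top, .var (.loc (Var.inr Γ _ v)))]
  | _, .read j e => ((m.updA j).ren
      (Env.cons (C := Var (Δ ++ Δ')) (Var.inr Δ _ e) Var.inl) Var.inl).cases

/-- The cases for the value of a term after a transition. -/
def Move.termCases (m : Move D A Δ Γ) {Δ' : List A.ASrt} {Γ' : List D.sig.Srt} :
    {s : D.sig.Srt} → ATerm A Δ' Γ' s →
      List (AQF A (Δ ++ Δ') (Γ ++ Γ') × ATerm A (Δ ++ Δ') (Γ ++ Γ') s)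
  | _, .var v => m.varCases _ v
  | _, .const c => [(.top, .const c)]
  | _, .app f t => (m.termCases t).map fun p => (p.1, .app f p.2)

/-- The formula saying that an atom holds after a transition. -/
def Move.preAtom (m : Move D A Δ Γ) {Δ' : List A.ASrt} {Γ' : List D.sig.Srt} :
    AAtom A Δ' Γ' → AQF A (Δ ++ Δ') (Γ ++ Γ')
  | .basicEq q => .disj ((m.termCases q.lhs).flatMap fun p => (m.termCases q.rhs).map fun p' =>
      .and p.1 (.and p'.1 (.atom (.basicEq ⟨q.sort, p.2, p'.2⟩))))
  | .artEq E e e' => .atom (.artEq E (Var.inr Δ E e) (Var.inr Δ E e'))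

/-- The matrix of the preimage under a transition. -/
def Move.preMatrix (m : Move D A Δ Γ) (φ : ExistsFormula A) :
    AQF A (Δ ++ φ.arts) (Γ ++ φ.basics) :=
  .and (AQF.ren Var.inl Var.inl m.guard) (φ.matrix.bind m.preAtom)

/-- The preimage of an existential formula under a disjunction of transitions. -/
def preimage (ms : List (Move D A Δ Γ)) (φ : ExistsFormula A) : ExistsFormula A :=
  ⟨Δ ++ φ.arts, Γ ++ φ.basics, .disj (ms.map fun m => m.preMatrix φ)⟩

section Semantics

variable {M : ExtStruct A} {st st' : State M} (m : Move D A Δ Γ)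
  (δ : Env M.entries (Δ ++ Δ')) (ρ : Env M.db.carrier (Γ ++ Γ'))

theorem Move.varCases_iff (hM : D.IsModel M.db)
    (h : m.HoldsAt st st' (fun E e => δ E (Var.inl E e))
      (fun s v => ρ s (Var.inl s v))) (s : D.sig.Srt) (v : AVar A Δ' Γ' s) (b : M.db.carrier s) :
    (∃ p ∈ m.varCases s v, AQF.Holds st δ ρ p.1 ∧ b = ATerm.eval st δ ρ p.2) ↔
      b = AVar.eval st' (fun E e => δ E (Var.inr Δ E e)) (fun s v => ρ s (Var.inr Γ s v)) s v := by
  obtain ⟨_, hX, hA⟩ := h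
  cases v with
  | art i =>
    refine (((m.updX_partition i).ren Var.inl Var.inl).hasValue_iff hM st δ ρ b).symm.trans ?_
    rw [CaseFun.hasValue_ren]
    exact ⟨fun hb => (m.updX_partition i).value_unique hM hb (hX i), fun hb => hb ▸ hX i⟩
  | loc v =>
    simp only [Move.varCases, List.mem_singleton, exists_eq_left]
    exact ⟨fun h => h.2, fun h => ⟨(BF.holds_top _).2 trivial, h⟩⟩
  | read j e =>
    refine (((m.updA_partition j).ren (Env.cons (C := Var (Δ ++ Δ')) (Var.inr Δ _ e) Var.inl)
      Var.inl).hasValue_iff hM st δ ρ b).symm.trans ?_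
    refine (CaseFun.hasValue_ren _ _ (m.updA j) st δ ρ b).trans ?_
    have : (fun E e' => δ E (Env.cons (C := Var (Δ ++ Δ')) (Var.inr Δ _ e) Var.inl E e')) =
        Env.cons (δ _ (Var.inr Δ _ e)) (fun E e => δ E (Var.inl E e)) := by
      funext E e'
      cases e' <;> rfl
    rw [this]
    exact ⟨fun hb => (m.updA_partition j).value_unique hM hb (hA j _), fun hb => hb ▸ hA j _⟩

theorem Move.termCases_iff (hM : D.IsModel M.db)
    (h : m.HoldsAt st st' (fun E e => δ E (Var.inl E e))
      (fun s v => ρ s (Var.inl s v))) {s : D.sig.Srt} (t : ATerm A Δ' Γ' s)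
      (b : M.db.carrier s) :
    (∃ p ∈ m.termCases t, AQF.Holds st δ ρ p.1 ∧ b = ATerm.eval st δ ρ p.2) ↔
      b = ATerm.eval st' (fun E e => δ E (Var.inr Δ E e)) (fun s v => ρ s (Var.inr Γ s v)) t := by
  induction t with
  | var v => exact m.varCases_iff δ ρ hM h _ v b
  | const c =>
    simp only [Move.termCases, List.mem_singleton, exists_eq_left]
    exact ⟨fun h => h.2, fun h => ⟨(BF.holds_top _).2 trivial, h⟩⟩
  | app f t ih =>
    simp only [Move.termCases, List.mem_map, exists_exists_and_eq_and]
    constructor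
    · rintro ⟨p, hp, hκ, rfl⟩
      exact congrArg (M.db.fn f) ((ih _).1 ⟨p, hp, hκ, rfl⟩)
    · rintro rfl
      obtain ⟨p, hp, hκ, he⟩ := (ih _).2 rfl
      exact ⟨p, hp, hκ, congrArg (M.db.fn f) he⟩

theorem Move.holds_preAtom (hM : D.IsModel M.db)
    (h : m.HoldsAt st st' (fun E e => δ E (Var.inl E e))
      (fun s v => ρ s (Var.inl s v))) (a : AAtom A Δ' Γ') :
    BF.Holds (AAtom.Holds st δ ρ) (m.preAtom a) ↔
      a.Holds st' (fun E e => δ E (Var.inr Δ E e)) (fun s v => ρ s (Var.inr Γ s v)) := by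
  cases a with
  | artEq E e e' => exact Iff.rfl
  | basicEq q =>
    have hl := m.termCases_iff δ ρ hM h q.lhs
    have hr := m.termCases_iff δ ρ hM h q.rhs
    unfold Move.preAtom
    rw [BF.holds_disj]
    constructor
    · rintro ⟨_, hm, hh⟩
      obtain ⟨p, hp, hm⟩ := List.mem_flatMap.1 hm
      obtain ⟨p', hp', rfl⟩ := List.mem_map.1 hm
      obtain ⟨h1, h2, h3⟩ := hh
      exact ((hl _).1 ⟨p, hp, h1, rfl⟩).symm.trans (h3.trans ((hr _).1 ⟨p', hp', h2, rfl⟩))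
    · intro hq
      obtain ⟨p, hp, h1, e1⟩ := (hl _).2 rfl
      obtain ⟨p', hp', h2, e2⟩ := (hr _).2 rfl
      exact ⟨_, List.mem_flatMap.2 ⟨p, hp, List.mem_map.2 ⟨p', hp', rfl⟩⟩, h1, h2,
        e1.symm.trans (Eq.trans hq e2)⟩

theorem Move.exists_target (hM : D.IsModel M.db)
    (hg : AQF.Holds st (fun E e => δ E (Var.inl E e))
      (fun s v => ρ s (Var.inl s v)) m.guard) :
    ∃ st' : State M, m.HoldsAt st st' (fun E e => δ E (Var.inl E e))
      (fun s v => ρ s (Var.inl s v)) := by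
  choose x hx using fun i => (m.updX_partition i).exists_value hM st
    (fun E e => δ E (Var.inl E e)) (fun s v => ρ s (Var.inl s v))
  choose a ha using fun j (y : M.entries (A.compSrc j)) => (m.updA_partition j).exists_value hM st
    (Env.cons y fun E e => δ E (Var.inl E e)) (fun s v => ρ s (Var.inl s v))
  exact ⟨⟨x, a⟩, hg, hx, ha⟩

theorem holds_preimage (hM : D.IsModel M.db) (ms : List (Move D A Δ Γ)) (φ : ExistsFormula A)
    (st : State M) :
    (preimage ms φ).Holds st ↔ ∃ st' : State M, (∃ m ∈ ms, m.Holds st st') ∧ φ.Holds st' := by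
  constructor
  · rintro ⟨δ, ρ, h⟩
    obtain ⟨_, hm, h⟩ := (BF.holds_disj _ _).1 h
    obtain ⟨m, hmem, rfl⟩ := List.mem_map.1 hm
    obtain ⟨st', hst'⟩ := m.exists_target δ ρ hM ((AQF.holds_ren ..).1 h.1)
    refine ⟨st', ⟨m, hmem, _, _, hst'⟩, fun E e => δ E (Var.inr Δ E e),
      fun s v => ρ s (Var.inr Γ s v), ?_⟩
    exact (BF.holds_congr (fun a => m.holds_preAtom δ ρ hM hst' a) φ.matrix).1
      ((BF.holds_bind _ _ _).1 h.2)
  · rintro ⟨st', ⟨m, hm, δ₁, ρ₁, hst'⟩, δ₂, ρ₂, hφ⟩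
    have hst : m.HoldsAt st st' (fun E e => Env.append δ₁ δ₂ E (Var.inl E e))
        (fun s v => Env.append ρ₁ ρ₂ s (Var.inl s v)) := by
      rwa [Env.append_inl, Env.append_inl]
    refine ⟨δ₁.append δ₂, ρ₁.append ρ₂, (BF.holds_disj _ _).2
      ⟨_, List.mem_map.2 ⟨m, hm, rfl⟩, (AQF.holds_ren ..).2 hst.1, ?_⟩⟩
    refine (BF.holds_bind _ _ _).2
      ((BF.holds_congr (fun a => m.holds_preAtom _ _ hM hst a) φ.matrix).2 ?_)
    rw [Env.append_inr, Env.append_inr]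
    exact hφ

end Semantics

/-! ### Preimages are effective -/

/-- Words for the cases of a case-defined function. -/
abbrev CaseWord (Sg : DBSig) : Type := AQFWord Sg × TermWord Sg

/-- The word of one case. -/
def caseWord {s : D.sig.Srt} (p : AQF A Δ Γ × ATerm A Δ Γ s) : CaseWord D.sig :=
  (p.1.word AAtom.word, Term.word AVar.num p.2)

/-- Renaming of entries in the word of a case. -/
def caseWordRen {Sg : DBSig} (r : ℕ → ℕ) (p : CaseWord Sg) : CaseWord Sg :=
  (aqfWordRen r p.1, TermWord.ren (renNum r) p.2)

theorem CaseFun.word_ren {s : D.sig.Srt} {rA : ∀ E, Var Δ E → Var Δ' E}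
    {rB : ∀ s, Var Γ s → Var Γ' s} {r : ℕ → ℕ} (hA : ∀ E e, (rA E e).idx = r e.idx)
    (hB : ∀ s v, (rB s v).idx = v.idx) (F : CaseFun A Δ Γ s) :
    (F.ren rA rB).cases.map caseWord = (F.cases.map caseWord).map (caseWordRen r) := by
  simp only [CaseFun.ren, List.map_map]
  refine List.map_congr_left fun p _ => ?_
  exact Prod.ext (AQF.word_ren hA hB p.1) (ATerm.word_ren hA hB p.2)

@[fun_prop] theorem primrec_caseWordRen {Sg : DBSig} {α : Type} [Primcodable α] {r : α → ℕ → ℕ}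
    {p : α → CaseWord Sg} (hr : Primrec fun p : α × ℕ => r p.1 p.2) (hp : Primrec p) :
    Primrec fun a => caseWordRen (r a) (p a) := by
  unfold caseWordRen
  fun_prop

/-- The effect on positions of replacing the first of the entry variables of a transition by the
`n`-th entry variable of a formula, if the transition has `k` further entry variables. -/
def instIdx (k n i : ℕ) : ℕ := if i = 0 then k + n else i - 1

/-- The words of the cases for the value of a variable after a transition. -/
def Move.varCasesWord (m : Move D A Δ Γ) (n : ℕ) : List (CaseWord D.sig) :=
  if n % 3 = 0 then
    ((List.ofFn fun i => ((m.updX i).cases.map caseWord).map (caseWordRen id))[n / 3]?).getD []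
  else if n % 3 = 1 then [(BF.topWord, ([], .inl (3 * (Γ.length + n / 3) + 1)))]
  else (((List.ofFn fun j => (m.updA j).cases.map caseWord)[(Nat.unpair (n / 3)).1]?).getD []).map
    (caseWordRen (instIdx Δ.length (Nat.unpair (n / 3)).2))

theorem Move.word_varCases (m : Move D A Δ Γ) (s : D.sig.Srt) (v : AVar A Δ' Γ' s) :
    (m.varCases s v).map caseWord = m.varCasesWord (AVar.num s v) := by
  cases v with
  | art i =>
    have h : 3 * i.val % 3 = 0 := by omega
    have h' : 3 * i.val / 3 = i.val := by omega
    rw [Move.varCasesWord, AVar.num, if_pos h, h', List.getElem?_ofFn, dif_pos i.isLt]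
    exact CaseFun.word_ren (fun E e => Var.idx_inl e) (fun s v => Var.idx_inl v) (m.updX i)
  | loc v =>
    have h : ¬ (3 * v.idx + 1) % 3 = 0 := by omega
    have h' : (3 * v.idx + 1) % 3 = 1 := by omega
    have h'' : (3 * v.idx + 1) / 3 = v.idx := by omega
    rw [Move.varCasesWord, AVar.num, if_neg h, if_pos h', h'']
    simp [Move.varCases, caseWord, Term.word, AVar.num, Var.idx_inr, BF.word_top]
  | read j e =>
    have h : ¬ (3 * Nat.pair j.val e.idx + 2) % 3 = 0 := by omega
    have h' : ¬ (3 * Nat.pair j.val e.idx + 2) % 3 = 1 := by omega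
    have h'' : (3 * Nat.pair j.val e.idx + 2) / 3 = Nat.pair j.val e.idx := by omega
    rw [Move.varCasesWord, AVar.num, if_neg h, if_neg h', h'', Nat.unpair_pair,
      List.getElem?_ofFn, dif_pos j.isLt]
    refine CaseFun.word_ren (fun E e' => ?_) (fun s v => Var.idx_inl v) (m.updA j)
    cases e' with
    | zero => exact Var.idx_inr e
    | succ e' => exact Var.idx_inl e'

@[fun_prop] theorem Move.primrec_varCasesWord (m : Move D A Δ Γ) {α : Type} [Primcodable α]
    {n : α → ℕ} (hn : Primrec n) : Primrec fun a => m.varCasesWord (n a) := by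
  unfold Move.varCasesWord instIdx
  fun_prop

/-- The words of the cases for the value of a term after a transition. -/
def Move.termCasesWord (m : Move D A Δ Γ) (w : TermWord D.sig) : List (CaseWord D.sig) :=
  (Sum.elim (fun n => m.varCasesWord n) (fun c => [(BF.topWord, ([], .inr c))]) w.2).map
    fun p => (p.1, (w.1 ++ p.2.1, p.2.2))

theorem Move.word_termCases (m : Move D A Δ Γ) {s : D.sig.Srt} (t : ATerm A Δ' Γ' s) :
    (m.termCases t).map caseWord = m.termCasesWord (Term.word AVar.num t) := by
  induction t with
  | var v => simp [Move.termCases, Move.termCasesWord, Term.word, Move.word_varCases]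
  | const c =>
    simp [Move.termCases, Move.termCasesWord, Term.word, caseWord, BF.word_top]
  | app f t ih =>
    simp only [Move.termCases, Term.word, List.map_map]
    have : (m.termCasesWord (f :: (Term.word AVar.num t).1, (Term.word AVar.num t).2)) =
        (m.termCasesWord (Term.word AVar.num t)).map fun p => (p.1, (f :: p.2.1, p.2.2)) := by
      simp [Move.termCasesWord, List.map_map, Function.comp_def]
    rw [this, ← ih, List.map_map]
    rfl

@[fun_prop] theorem Move.primrec_termCasesWord (m : Move D A Δ Γ) {α : Type} [Primcodable α]
    {w : α → TermWord D.sig} (hw : Primrec w) : Primrec fun a => m.termCasesWord (w a) := by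
  unfold Move.termCasesWord
  fun_prop

/-- The word of the formula saying that an atom holds after a transition. -/
def Move.preAtomWord (m : Move D A Δ Γ) : EqWord D.sig ⊕ (ℕ × ℕ) → AQFWord D.sig :=
  Sum.elim
    (fun q => BF.disjWord ((m.termCasesWord q.2.1).flatMap fun p =>
      (m.termCasesWord q.2.2).map fun p' =>
        .inl 2 :: (p.1 ++ .inl 2 :: (p'.1 ++ [.inr (.inl (q.1, p.2, p'.2))]))))
    (fun p => [.inr (.inr (Δ.length + p.1, Δ.length + p.2))])

theorem Move.word_preAtom (m : Move D A Δ Γ) (a : AAtom A Δ' Γ') :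
    (m.preAtom a).word AAtom.word = m.preAtomWord a.word := by
  cases a with
  | artEq E e e' => simp [Move.preAtom, Move.preAtomWord, BF.word, AAtom.word, Var.idx_inr]
  | basicEq q =>
    simp only [Move.preAtom, Move.preAtomWord, AAtom.word, Sum.elim_inl, BF.word_disj,
      EqAtom.word, ← Move.word_termCases, List.map_flatMap, List.flatMap_map, List.map_map]
    rfl

@[fun_prop] theorem Move.primrec_preAtomWord (m : Move D A Δ Γ) {α : Type} [Primcodable α]
    {w : α → EqWord D.sig ⊕ (ℕ × ℕ)} (hw : Primrec w) : Primrec fun a => m.preAtomWord (w a) := by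
  unfold Move.preAtomWord
  fun_prop

/-- The word of the matrix of the preimage under a transition. -/
def Move.preMatrixWord (m : Move D A Δ Γ) (w : AQFWord D.sig) : AQFWord D.sig :=
  .inl 2 :: (aqfWordRen id (m.guard.word AAtom.word) ++ BF.wordBind m.preAtomWord w)

theorem Move.word_preMatrix (m : Move D A Δ Γ) (φ : ExistsFormula A) :
    (m.preMatrix φ).word AAtom.word = m.preMatrixWord (φ.matrix.word AAtom.word) := by
  unfold Move.preMatrix Move.preMatrixWord
  rw [BF.word, AQF.word_ren (r := id) (fun E e => Var.idx_inl e) (fun s v => Var.idx_inl v),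
    BF.word_bind m.word_preAtom]

@[fun_prop] theorem Move.primrec_preMatrixWord (m : Move D A Δ Γ) {α : Type} [Primcodable α]
    {w : α → AQFWord D.sig} (hw : Primrec w) : Primrec fun a => m.preMatrixWord (w a) := by
  unfold Move.preMatrixWord
  fun_prop

theorem primrec_map_fixed {ι α σ : Type} [Primcodable α] [Primcodable σ] (l : List ι)
    {F : ι → α → σ} (hF : ∀ i, Primrec (F i)) : Primrec fun a => l.map fun i => F i a := by
  induction l with
  | nil => exact Primrec.const []
  | cons i l ih =>
    have := hF i
    simp only [List.map_cons]
    fun_prop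

theorem preimage_effective (ms : List (Move D A Δ Γ)) :
    Effective StateFormula.word fun φ : StateFormula A => (preimage ms φ.toExists).word := by
  have hm : Primrec fun w : AQFWord D.sig => ms.map fun m => m.preMatrixWord w :=
    primrec_map_fixed ms fun m => by fun_prop
  have h : Primrec fun w : List A.ASrt × AQFWord D.sig =>
      (Δ ++ w.1, Γ, BF.disjWord (ms.map fun m => m.preMatrixWord w.2)) := by
    have := hm.comp (Primrec.snd (α := List A.ASrt))
    fun_prop
  refine ⟨_, h.to_comp, fun φ => ?_⟩
  refine Prod.ext rfl (Prod.ext (List.append_nil Γ).symm ?_)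
  simp only [preimage, ExistsFormula.word, BF.word_disj, List.map_map]
  refine congrArg BF.disjWord (List.map_congr_left fun m _ => ?_)
  exact (m.word_preMatrix φ.toExists).symm

end Move

/-! ### Invariance of state formulae under embeddings of the database -/

section Embedding

theorem Term.eval_embedding {Sg : DBSig} {V : Sg.Srt → Type} {M N : Struct Sg}
    (f : Embedding M N) (ρ : ∀ s, V s → M.carrier s) {s : Sg.Srt} (t : Term Sg V s) :
    t.eval N (fun s v => f.map s (ρ s v)) = f.map s (t.eval M ρ) := by
  induction t with
  | var v => rfl
  | const c => exact (f.map_const c).symm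
  | app g t ih =>
    simp only [Term.eval, ih]
    exact (f.map_fn g _).symm

variable {Sg : DBSig} {A : ArtifactSetting Sg} {M : ExtStruct A} {N : Struct Sg}

/-- Replacing the database of a structure. -/
def ExtStruct.withDB (M : ExtStruct A) (N : Struct Sg) : ExtStruct A :=
  ⟨N, M.entries, M.entries_nonempty⟩

/-- The image of a state under an embedding of the database. -/
def State.push (f : Embedding M.db N) (st : State M) : State (M.withDB N) :=
  ⟨fun i => f.map _ (st.x i), fun j y => f.map _ (st.a j y)⟩

variable {Δ : List A.ASrt} {Γ : List Sg.Srt}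

theorem AVar.eval_push (f : Embedding M.db N) (st : State M) (δ : Env M.entries Δ)
    (ρ : Env M.db.carrier Γ) :
    AVar.eval (st.push f) δ (fun s v => f.map s (ρ s v)) =
      fun s v => f.map s (AVar.eval st δ ρ s v) := by
  funext s v
  cases v <;> rfl

theorem ATerm.eval_push (f : Embedding M.db N) (st : State M) (δ : Env M.entries Δ)
    (ρ : Env M.db.carrier Γ) {s : Sg.Srt} (t : ATerm A Δ Γ s) :
    ATerm.eval (st.push f) δ (fun s v => f.map s (ρ s v)) t = f.map s (ATerm.eval st δ ρ t) := by
  unfold ATerm.eval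
  rw [AVar.eval_push]
  exact Term.eval_embedding f _ t

theorem AQF.holds_push (f : Embedding M.db N) (st : State M) (δ : Env M.entries Δ)
    (ρ : Env M.db.carrier Γ) (φ : AQF A Δ Γ) :
    AQF.Holds (st.push f) δ (fun s v => f.map s (ρ s v)) φ ↔ AQF.Holds st δ ρ φ := by
  refine BF.holds_congr (fun a => ?_) φ
  cases a with
  | artEq E e e' => exact Iff.rfl
  | basicEq q =>
    have hl := ATerm.eval_push f st δ ρ q.lhs
    have hr := ATerm.eval_push f st δ ρ q.rhs
    exact (iff_of_eq (congrArg₂ Eq hl hr)).trans (f.injective _).eq_iff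

theorem StateFormula.holds_push (f : Embedding M.db N) (st : State M) (φ : StateFormula A) :
    φ.Holds (st.push f) ↔ φ.Holds st := by
  constructor
  · rintro ⟨δ, ρ, h⟩
    refine ⟨δ, Env.nil, (AQF.holds_push f st δ Env.nil φ.matrix).1 ?_⟩
    have e : ρ = fun s v => f.map s (Env.nil s v) := by
      funext s v
      exact v.elim0
    rwa [e] at h
  · rintro ⟨δ, ρ, h⟩
    exact ⟨δ, _, (AQF.holds_push f st δ ρ φ.matrix).2 h⟩

theorem CaseFun.HasValue.push {s : Sg.Srt} {F : CaseFun A Δ Γ s} (f : Embedding M.db N)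
    {st : State M} {δ : Env M.entries Δ} {ρ : Env M.db.carrier Γ} {b : M.db.carrier s}
    (h : F.HasValue st δ ρ b) :
    F.HasValue (st.push f) δ (fun s v => f.map s (ρ s v)) (f.map s b) := by
  intro p hp hκ
  rw [ATerm.eval_push, ← h p hp ((AQF.holds_push f st δ ρ p.1).1 hκ)]

end Embedding

section System

variable {D : DBSchema} (S : RAS D)

theorem RAS.init_push {M : ExtStruct S.setting} {N : Struct D.sig} (f : Embedding M.db N)
    (st : State M) : S.Init (st.push f) ↔ S.Init st := by
  simp only [RAS.init_iff, StateFormula.holds_push]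

theorem RAS.Step.push {M : ExtStruct S.setting} {N : Struct D.sig} (f : Embedding M.db N)
    {st st' : State M} (h : S.Step st st') : S.Step (st.push f) (st'.push f) := by
  obtain ⟨t, ht, δ, ρ, hg, hX, hA⟩ := h
  exact ⟨t, ht, δ, _, (AQF.holds_push f st δ ρ t.guard).2 hg, fun i => (hX i).push f,
    fun j y => (hA j y).push f⟩

/-! ### Runs leading to a state formula -/

/-- A run of length `n` leads from the given state to a state satisfying `υ`. -/
def RAS.Leads (υ : StateFormula S.setting) {M : ExtStruct S.setting} : ℕ → State M → Prop
  | 0, st => υ.Holds st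
  | n + 1, st => ∃ st', S.Step st st' ∧ RAS.Leads υ n st'

theorem RAS.Leads.push {υ : StateFormula S.setting} {M : ExtStruct S.setting} {N : Struct D.sig}
    (f : Embedding M.db N) {n : ℕ} {st : State M} (h : S.Leads υ n st) :
    S.Leads υ n (st.push f) := by
  induction n generalizing st with
  | zero => exact (StateFormula.holds_push f st υ).2 h
  | succ n ih =>
    obtain ⟨st', hs, h⟩ := h
    exact ⟨_, hs.push S f, ih h⟩

theorem RAS.leads_iff_run (υ : StateFormula S.setting) {M : ExtStruct S.setting} (n : ℕ)
    (st : State M) :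
    S.Leads υ n st ↔ ∃ run : Fin (n + 1) → State M, run 0 = st ∧
      (∀ i : Fin n, S.Step (run i.castSucc) (run i.succ)) ∧ υ.Holds (run (Fin.last n)) := by
  induction n generalizing st with
  | zero =>
    constructor
    · exact fun h => ⟨fun _ => st, rfl, fun i => i.elim0, h⟩
    · rintro ⟨run, rfl, _, h⟩
      exact h
  | succ n ih =>
    constructor
    · rintro ⟨st', hs, h⟩
      obtain ⟨run, rfl, hstep, hlast⟩ := (ih st').1 h
      refine ⟨Fin.cons st run, rfl, fun i => ?_, hlast⟩
      refine Fin.cases ?_ (fun i => ?_) i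
      · exact hs
      · exact hstep i
    · rintro ⟨run, rfl, hstep, hlast⟩
      exact ⟨run (Fin.succ 0), hstep 0, (ih _).2
        ⟨fun i => run i.succ, rfl, fun i => hstep i.succ, hlast⟩⟩

theorem RAS.not_safe_iff (υ : StateFormula S.setting) :
    ¬ S.Safe υ ↔ ∃ M : ExtStruct S.setting, D.IsInstance M.db ∧ ∃ (n : ℕ) (st : State M),
      S.Init st ∧ S.Leads υ n st := by
  unfold RAS.Safe
  rw [not_not]
  refine exists_congr fun M => and_congr Iff.rfl (exists_congr fun n => ?_)
  constructor
  · rintro ⟨run, hi, hs, hl⟩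
    exact ⟨run 0, hi, (S.leads_iff_run υ n _).2 ⟨run, rfl, hs, hl⟩⟩
  · rintro ⟨st, hi, h⟩
    obtain ⟨run, rfl, hs, hl⟩ := (S.leads_iff_run υ n st).1 h
    exact ⟨run, hi, hs, hl⟩

theorem RAS.Leads.split {υ : StateFormula S.setting} {M : ExtStruct S.setting} (a b : ℕ)
    {st : State M} (h : S.Leads υ (a + b) st) :
    ∃ st' : State M, S.Leads υ b st' ∧ ∀ m, S.Leads υ m st' → S.Leads υ (a + m) st := by
  induction a generalizing st with
  | zero => exact ⟨st, by simpa using h, fun m hm => by simpa using hm⟩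
  | succ a ih =>
    rw [Nat.succ_add] at h
    obtain ⟨st₁, hs, h⟩ := h
    obtain ⟨st', hb, hm⟩ := ih h
    refine ⟨st', hb, fun m hl => ?_⟩
    rw [Nat.succ_add]
    exact ⟨st₁, hs, hm m hl⟩

/-- Unsafety is witnessed by an arbitrary model of the DB theory. -/
theorem RAS.not_safe_of_leads (hfmp : D.FiniteModelProperty) (υ : StateFormula S.setting)
    {M : ExtStruct S.setting} (hM : D.IsModel M.db) {n : ℕ} {st : State M} (hi : S.Init st)
    (h : S.Leads υ n st) : ¬ S.Safe υ := by
  obtain ⟨Δ, Γ, ms, hms⟩ := exists_moves S.trans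
  have key : ∀ {N : ExtStruct S.setting}, D.IsModel N.db → ∀ (n : ℕ) (st : State N),
      ((preimage ms)^[n] υ.toExists).Holds st ↔ S.Leads υ n st := by
    intro N hN n
    induction n with
    | zero => exact fun st => υ.holds_toExists st
    | succ n ih =>
      intro st
      rw [Function.iterate_succ_apply', holds_preimage hN]
      exact exists_congr fun st' => and_congr (hms N st st').symm (ih st')
  obtain ⟨N, hN, st', h', hi'⟩ := exists_instance_of_exists_model hfmp
    ((preimage ms)^[n] υ.toExists) S.initNeg
    ⟨M, hM, st, (key hM n st).2 h, (S.init_iff st).1 hi⟩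
  exact (S.not_safe_iff υ).2 ⟨N, hN, n, st', (S.init_iff st').2 hi', (key hN.1 n st').1 h'⟩

/-! ### Partial correctness of backward reachability -/

variable (pre : StateFormula S.setting → ExistsFormula S.setting)
  (qe : ExistsFormula S.setting → StateFormula S.setting)

/-- The values of `φ` in the loop. -/
def RAS.frontier (υ : StateFormula S.setting) : ℕ → StateFormula S.setting
  | 0 => υ
  | n + 1 => qe (pre (RAS.frontier υ n))

/-- The values of `B` in the loop. -/
def RAS.visited (υ : StateFormula S.setting) : ℕ → List (StateFormula S.setting)
  | 0 => []
  | n + 1 => S.frontier pre qe υ n :: RAS.visited υ n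

theorem RAS.mem_visited {υ : StateFormula S.setting} {n : ℕ} {ψ : StateFormula S.setting}
    (h : ψ ∈ S.visited pre qe υ n) : ∃ m < n, ψ = S.frontier pre qe υ m := by
  induction n with
  | zero => simp [RAS.visited] at h
  | succ n ih =>
    rcases List.mem_cons.1 h with rfl | h
    · exact ⟨n, n.lt_succ_self, rfl⟩
    · obtain ⟨m, hm, e⟩ := ih h
      exact ⟨m, hm.trans n.lt_succ_self, e⟩

theorem RAS.Loop.deterministic {φ : StateFormula S.setting} {B : List (StateFormula S.setting)}
    {r r' : Answer S} (h : S.Loop pre qe φ B r) (h' : S.Loop pre qe φ B r') : r = r' := by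
  induction h with
  | fixpoint φ B hf =>
    cases h' with
    | fixpoint _ _ _ => rfl
    | hit _ _ h1 _ => exact absurd h1 hf
    | next _ _ _ h1 _ _ => exact absurd h1 hf
  | hit φ B hf hi =>
    cases h' with
    | fixpoint _ _ h1 => exact absurd hf h1
    | hit _ _ _ _ => rfl
    | next _ _ _ _ h2 _ => exact absurd hi h2
  | next φ B r hf hi _ ih =>
    cases h' with
    | fixpoint _ _ h1 => exact absurd hf h1
    | hit _ _ _ h2 => exact absurd h2 hi
    | next _ _ _ _ _ h3 => exact ih h3

theorem RAS.Loop.exists_initSat {υ φ : StateFormula S.setting}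
    {B : List (StateFormula S.setting)} {r : Answer S} (h : S.Loop pre qe φ B r)
    (hr : r = .unsafeAnswer) {n : ℕ} (hφ : φ = S.frontier pre qe υ n) :
    ∃ m, S.InitSat (S.frontier pre qe υ m) := by
  induction h generalizing n with
  | fixpoint φ B hf => cases hr
  | hit φ B hf hi => exact ⟨n, hφ ▸ hi⟩
  | next φ B r hf hi _ ih => exact ih hr (n := n + 1) (by rw [hφ]; rfl)

variable {pre qe} {Tstar : Set (Fml D.sig [])}

theorem RAS.holds_frontier_iff (hmc : D.IsModelCompletion Tstar) (hpre : S.IsPreimage pre)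
    (hqe : S.IsQE Tstar qe) (υ : StateFormula S.setting) {M : ExtStruct S.setting}
    (hM : IsModelOf Tstar M.db) (n : ℕ) (st : State M) :
    (S.frontier pre qe υ n).Holds st ↔ S.Leads υ n st := by
  induction n generalizing st with
  | zero => exact Iff.rfl
  | succ n ih =>
    refine (hqe _ M hM st).trans ((hpre _ M (hmc.extends_theory _ hM) st).trans ?_)
    exact exists_congr fun st' => and_congr Iff.rfl (ih st')

theorem RAS.initSat_frontier_iff (hmc : D.IsModelCompletion Tstar) (hpre : S.IsPreimage pre)
    (hqe : S.IsQE Tstar qe) (υ : StateFormula S.setting) (n : ℕ) :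
    S.InitSat (S.frontier pre qe υ n) ↔ ∃ M : ExtStruct S.setting, IsModelOf Tstar M.db ∧
      ∃ st : State M, S.Init st ∧ S.Leads υ n st := by
  constructor
  · rintro ⟨M, hM, st, hi, h⟩
    obtain ⟨N, hN, ⟨f⟩⟩ := hmc.embeds M.db hM
    exact ⟨M.withDB N, hN, st.push f, (S.init_push f st).2 hi,
      (S.holds_frontier_iff hmc hpre hqe υ (M := M.withDB N) hN n _).1
        ((StateFormula.holds_push f st _).2 h)⟩
  · rintro ⟨M, hM, st, hi, h⟩
    exact ⟨M, hmc.extends_theory _ hM, st, hi,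
      (S.holds_frontier_iff hmc hpre hqe υ hM n st).2 h⟩

theorem RAS.not_safe_iff_exists_initSat (hfmp : D.FiniteModelProperty)
    (hmc : D.IsModelCompletion Tstar) (hpre : S.IsPreimage pre) (hqe : S.IsQE Tstar qe)
    (υ : StateFormula S.setting) :
    ¬ S.Safe υ ↔ ∃ n, S.InitSat (S.frontier pre qe υ n) := by
  constructor
  · intro h
    obtain ⟨M, hM, n, st, hi, hl⟩ := (S.not_safe_iff υ).1 h
    obtain ⟨N, hN, ⟨f⟩⟩ := hmc.embeds M.db hM.1
    exact ⟨n, (S.initSat_frontier_iff hmc hpre hqe υ n).2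
      ⟨M.withDB N, hN, st.push f, (S.init_push f st).2 hi, hl.push S f⟩⟩
  · rintro ⟨n, h⟩
    obtain ⟨M, hM, st, hi, hl⟩ := (S.initSat_frontier_iff hmc hpre hqe υ n).1 h
    exact S.not_safe_of_leads hfmp υ (hmc.extends_theory _ hM) hi hl

theorem RAS.bReach_of_initSat (hmc : D.IsModelCompletion Tstar) (hpre : S.IsPreimage pre)
    (hqe : S.IsQE Tstar qe) (υ : StateFormula S.setting)
    (h : ∃ n, S.InitSat (S.frontier pre qe υ n)) : S.BReach pre qe υ .unsafeAnswer := by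
  classical
  let k := Nat.find h
  have hk : S.InitSat (S.frontier pre qe υ k) := Nat.find_spec h
  have hmin : ∀ m < k, ¬ S.InitSat (S.frontier pre qe υ m) := fun m hm => Nat.find_min h hm
  have hfr : ∀ a n, a + n = k → S.FrontierSat (S.frontier pre qe υ n) (S.visited pre qe υ n) := by
    intro a n han
    obtain ⟨M, hM, st, hi, hl⟩ := (S.initSat_frontier_iff hmc hpre hqe υ k).1 hk
    rw [← han] at hl
    obtain ⟨st', hn, hm⟩ := hl.split
    refine ⟨M, hmc.extends_theory _ hM, st',
      (S.holds_frontier_iff hmc hpre hqe υ hM n st').2 hn, ?_⟩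
    rintro ⟨ψ, hψ, hh⟩
    obtain ⟨m, hmn, rfl⟩ := S.mem_visited pre qe hψ
    refine hmin (a + m) (by omega) ((S.initSat_frontier_iff hmc hpre hqe υ _).2
      ⟨M, hM, st, hi, hm m ?_⟩)
    exact (S.holds_frontier_iff hmc hpre hqe υ hM m st').1 hh
  have key : ∀ a n, a + n = k →
      S.Loop pre qe (S.frontier pre qe υ n) (S.visited pre qe υ n) .unsafeAnswer := by
    intro a
    induction a with
    | zero =>
      intro n hn
      rw [Nat.zero_add] at hn
      exact .hit _ _ (hfr 0 n (by omega)) (hn ▸ hk)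
    | succ a ih =>
      intro n hn
      exact .next _ _ _ (hfr (a + 1) n hn) (hmin n (by omega)) (ih (n + 1) (by omega))
  exact key k 0 rfl

end System

end ArtifactSystems

theorem backward_reachability_effective_partially_correct
    (D : DBSchema) (Tstar : Set (Fml D.sig []))
    (hfmp : D.FiniteModelProperty)
    (hdec : D.DecidableConstraintSat)
    (hmc : D.IsModelCompletion Tstar)
    (hqe : HasEffectiveQE Tstar)
    (S : RAS D) :
    (EffectivelyDecidable
        (fun p : StateFormula S.setting × List (StateFormula S.setting) =>
          (p.1.word, p.2.map StateFormula.word))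
        (fun p => S.FrontierSat p.1 p.2) ∧
      EffectivelyDecidable StateFormula.word S.InitSat ∧
      (∃ pre, S.IsPreimage pre ∧
        Effective StateFormula.word (fun φ => (pre φ).word)) ∧
      (∃ qe, S.IsQE Tstar qe ∧
        Effective ExistsFormula.word (fun φ => (qe φ).word))) ∧
    (∀ pre qe, S.IsPreimage pre → S.IsQE Tstar qe → ∀ υ : StateFormula S.setting,
      (∀ B, S.BReach pre qe υ (.safeAnswer B) → S.Safe υ) ∧
      (S.BReach pre qe υ .unsafeAnswer → ¬ S.Safe υ) ∧
      (¬ S.Safe υ → S.BReach pre qe υ .unsafeAnswer)) := by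
  refine ⟨⟨S.frontierSat_decidable hdec, S.initSat_decidable hdec, ?_, ?_⟩, ?_⟩
  · obtain ⟨Δ, Γ, ms, hms⟩ := exists_moves S.trans
    refine ⟨fun φ => preimage ms φ.toExists, fun φ M hM st => ?_, preimage_effective ms⟩
    rw [holds_preimage hM]
    exact exists_congr fun st' => and_congr (hms M st st').symm (φ.holds_toExists st')
  · obtain ⟨qe, hspec, heff⟩ := hqe
    exact ⟨stateQE qe, fun φ M hM st => holds_stateQE qe hspec φ hM st,
      stateQE_effective S.setting qe heff⟩
  · intro pre qe hpre hq υ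
    have complete : ¬ S.Safe υ → S.BReach pre qe υ .unsafeAnswer := fun h =>
      S.bReach_of_initSat hmc hpre hq υ
        ((S.not_safe_iff_exists_initSat hfmp hmc hpre hq υ).1 h)
    refine ⟨fun B hB => ?_, fun h => ?_, complete⟩
    · by_contra hs
      cases RAS.Loop.deterministic S pre qe hB (complete hs)
    · exact (S.not_safe_iff_exists_initSat hfmp hmc hpre hq υ).2
        (RAS.Loop.exists_initSat S pre qe h rfl (n := 0) rfl)
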